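/- arXiv:1309.0435 — 4 statements merged into one kernel-verified Lean document; each statement's English description precedes it below -/
import Mathlib

section
/- Let G be a simple graph and let K be a smallest induced pyramid or prism in G (i.e., no induced pyramid or prism of G has strictly fewer vertices). Suppose K is a pyramid formed by chordless paths P1, P2, P3, with triangle {b1, b2, b3} and apex a. Let R1 be a shortest path of G from b1 to a whose interior vertices are not adjacent to b2 or b3. Then the subgraph of G induced by V(R1) ∪ V(P2) ∪ V(P3) is a smallest induced pyramid or prism of G. -/
open SimpleGraph

/-- A walk is a *chordless (induced) path*: it is a path and the only edges of `G`
between its vertices are the edges of the walk. -/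
def IsInducedPathW {V : Type*} (G : SimpleGraph V) {u v : V} (p : G.Walk u v) : Prop :=
  p.IsPath ∧ ∀ x y : V, x ∈ p.support → y ∈ p.support → G.Adj x y → p.toSubgraph.Adj x y

/-- A closed walk is a *hole*: an induced (chordless) cycle with at least 4 vertices. -/
def IsHoleW {V : Type*} (G : SimpleGraph V) {v : V} (c : G.Walk v v) : Prop :=
  c.IsCycle ∧ 4 ≤ c.length ∧
    ∀ x y : V, x ∈ c.support → y ∈ c.support → G.Adj x y → c.toSubgraph.Adj x y

/-- `G` contains an odd hole. -/
def HasOddHole {V : Type*} (G : SimpleGraph V) : Prop :=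
  ∃ (v : V) (c : G.Walk v v), IsHoleW G c ∧ Odd c.length

/-- Compatibility condition for two legs of a pyramid with apex `a`:
they meet only at `a`, and `bᵢbⱼ` is the only edge between them away from `a`. -/
def PyrPair {V : Type*} (G : SimpleGraph V) (a bi bj : V)
    (Pi : G.Walk a bi) (Pj : G.Walk a bj) : Prop :=
  (∀ x : V, x ∈ Pi.support → x ∈ Pj.support → x = a) ∧
  (∀ x ∈ Pi.support, ∀ y ∈ Pj.support, x ≠ a → y ≠ a → G.Adj x y → x = bi ∧ y = bj)

/-- The three paths `P₁, P₂, P₃` form a *pyramid* of `G` with triangle `{b₁,b₂,b₃}`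
and apex `a`. -/
def IsPyramid {V : Type*} (G : SimpleGraph V) (a b₁ b₂ b₃ : V)
    (P₁ : G.Walk a b₁) (P₂ : G.Walk a b₂) (P₃ : G.Walk a b₃) : Prop :=
  IsInducedPathW G P₁ ∧ IsInducedPathW G P₂ ∧ IsInducedPathW G P₃ ∧
  G.Adj b₁ b₂ ∧ G.Adj b₂ b₃ ∧ G.Adj b₁ b₃ ∧
  ¬(G.Adj a b₁ ∧ G.Adj a b₂) ∧ ¬(G.Adj a b₁ ∧ G.Adj a b₃) ∧ ¬(G.Adj a b₂ ∧ G.Adj a b₃) ∧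
  PyrPair G a b₁ b₂ P₁ P₂ ∧ PyrPair G a b₁ b₃ P₁ P₃ ∧ PyrPair G a b₂ b₃ P₂ P₃

/-- Compatibility condition for two paths of a prism: they are vertex-disjoint and
the only edges between them are the two triangle edges `aᵢaⱼ` and `bᵢbⱼ`. -/
def PriPair {V : Type*} (G : SimpleGraph V) (ai bi aj bj : V)
    (Pi : G.Walk ai bi) (Pj : G.Walk aj bj) : Prop :=
  (∀ x : V, x ∈ Pi.support → x ∉ Pj.support) ∧
  (∀ x ∈ Pi.support, ∀ y ∈ Pj.support, G.Adj x y → (x = ai ∧ y = aj) ∨ (x = bi ∧ y = bj))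

/-- The three paths `P₁, P₂, P₃` form a *prism* of `G` with triangles `{a₁,a₂,a₃}`
and `{b₁,b₂,b₃}`. -/
def IsPrism {V : Type*} (G : SimpleGraph V) (a₁ a₂ a₃ b₁ b₂ b₃ : V)
    (P₁ : G.Walk a₁ b₁) (P₂ : G.Walk a₂ b₂) (P₃ : G.Walk a₃ b₃) : Prop :=
  IsInducedPathW G P₁ ∧ IsInducedPathW G P₂ ∧ IsInducedPathW G P₃ ∧
  G.Adj a₁ a₂ ∧ G.Adj a₂ a₃ ∧ G.Adj a₁ a₃ ∧
  G.Adj b₁ b₂ ∧ G.Adj b₂ b₃ ∧ G.Adj b₁ b₃ ∧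
  a₁ ≠ b₁ ∧ a₂ ≠ b₂ ∧ a₃ ≠ b₃ ∧
  PriPair G a₁ b₁ a₂ b₂ P₁ P₂ ∧ PriPair G a₁ b₁ a₃ b₃ P₁ P₃ ∧ PriPair G a₂ b₂ a₃ b₃ P₂ P₃

/-- `G` contains an induced pyramid. -/
def HasPyramid {V : Type*} (G : SimpleGraph V) : Prop :=
  ∃ (a b₁ b₂ b₃ : V) (P₁ : G.Walk a b₁) (P₂ : G.Walk a b₂) (P₃ : G.Walk a b₃),
    IsPyramid G a b₁ b₂ b₃ P₁ P₂ P₃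

/-- `G` contains an induced prism. -/
def HasPrism {V : Type*} (G : SimpleGraph V) : Prop :=
  ∃ (a₁ a₂ a₃ b₁ b₂ b₃ : V) (P₁ : G.Walk a₁ b₁) (P₂ : G.Walk a₂ b₂) (P₃ : G.Walk a₃ b₃),
    IsPrism G a₁ a₂ a₃ b₁ b₂ b₃ P₁ P₂ P₃

/-- `G` has an induced pyramid whose vertex set is exactly `S`. -/
def HasPyramidOn {V : Type*} [DecidableEq V] (G : SimpleGraph V) (S : Finset V) : Prop :=
  ∃ (a b₁ b₂ b₃ : V) (P₁ : G.Walk a b₁) (P₂ : G.Walk a b₂) (P₃ : G.Walk a b₃),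
    IsPyramid G a b₁ b₂ b₃ P₁ P₂ P₃ ∧
    P₁.support.toFinset ∪ P₂.support.toFinset ∪ P₃.support.toFinset = S

/-- `G` has an induced prism whose vertex set is exactly `S`. -/
def HasPrismOn {V : Type*} [DecidableEq V] (G : SimpleGraph V) (S : Finset V) : Prop :=
  ∃ (a₁ a₂ a₃ b₁ b₂ b₃ : V) (P₁ : G.Walk a₁ b₁) (P₂ : G.Walk a₂ b₂) (P₃ : G.Walk a₃ b₃),
    IsPrism G a₁ a₂ a₃ b₁ b₂ b₃ P₁ P₂ P₃ ∧
    P₁.support.toFinset ∪ P₂.support.toFinset ∪ P₃.support.toFinset = S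

lemma mkPath {V : Type*} (G : SimpleGraph V) (l : ℕ) : ∀ (f : ℕ → V) (u v : V)
    (_ : f 0 = u) (_ : f l = v)
    (_ : ∀ i j, i < j → j ≤ l → f i ≠ f j)
    (_ : ∀ i, i < l → G.Adj (f i) (f (i+1))),
    ∃ p : G.Walk u v, p.IsPath ∧ p.length = l ∧ (∀ i, i ≤ l → p.getVert i = f i) := by
  induction l with
  | zero =>
    intro f u v hu hv _ _
    have : u = v := by rw [← hu, ← hv]
    subst this
    exact ⟨Walk.nil, by simp, by simp, by
      intro i hi
      have : i = 0 := by omega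
      subst this
      simpa using hu.symm⟩
  | succ l ih =>
    intro f u v hu hv hinj hadj
    obtain ⟨p, hp, hl, hg⟩ := ih (fun i => f (i+1)) (f 1) v rfl hv
      (fun i j hij hj => hinj _ _ (by omega) (by omega)) (fun i hi => hadj _ (by omega))
    have h0 : G.Adj u (f 1) := by rw [← hu]; exact hadj 0 (by omega)
    refine ⟨Walk.cons h0 p, ?_, by simp [hl], ?_⟩
    · rw [Walk.cons_isPath_iff]
      refine ⟨hp, fun hmem => ?_⟩
      obtain ⟨i, hi, hil⟩ := Walk.mem_support_iff_exists_getVert.1 hmem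
      rw [hg i (by omega), ← hu] at hi
      exact hinj 0 (i+1) (by omega) (by omega) hi.symm
    · intro i hi
      cases i with
      | zero => simp [hu]
      | succ i => simp; exact hg i (by omega)

lemma mkInd {V : Type*} (G : SimpleGraph V) (l : ℕ) (f : ℕ → V) (u v : V)
    (hu : f 0 = u) (hv : f l = v)
    (hinj : ∀ i j, i < j → j ≤ l → f i ≠ f j)
    (hadj : ∀ i j, i < j → j ≤ l → (G.Adj (f i) (f j) ↔ j = i + 1)) :
    ∃ p : G.Walk u v, IsInducedPathW G p ∧ ∀ x, x ∈ p.support ↔ ∃ i ≤ l, x = f i := by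
  obtain ⟨p, hp, hl, hg⟩ := mkPath G l f u v hu hv hinj
    (fun i hi => (hadj i (i+1) (by omega) (by omega)).2 rfl)
  have hs : ∀ x, x ∈ p.support ↔ ∃ i ≤ l, x = f i := by
    intro x
    rw [Walk.mem_support_iff_exists_getVert]
    constructor
    · rintro ⟨i, hi, hil⟩
      exact ⟨i, by omega, by rw [← hg i (by omega), hi]⟩
    · rintro ⟨i, hi, hil⟩
      exact ⟨i, by rw [hg i (by omega), hil], by omega⟩
  refine ⟨p, ⟨hp, ?_⟩, hs⟩
  intro x y hx hy hxy
  obtain ⟨i, hi, rfl⟩ := (hs x).1 hx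
  obtain ⟨j, hj, rfl⟩ := (hs y).1 hy
  rw [Walk.toSubgraph_adj_iff]
  rcases lt_trichotomy i j with h | h | h
  · have := (hadj i j h hj).1 hxy
    subst this
    exact ⟨i, by rw [hg i hi, hg (i+1) hj], by omega⟩
  · subst h; exact absurd hxy (G.loopless.irrefl _)
  · have := (hadj j i h hi).1 hxy.symm
    subst this
    exact ⟨j, by rw [hg j hj, hg (j+1) hi, Sym2.eq_swap], by omega⟩

lemma ofInd {V : Type*} (G : SimpleGraph V) {u v : V} (p : G.Walk u v)
    (hp : IsInducedPathW G p) :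
    (∀ i j, i < j → j ≤ p.length → p.getVert i ≠ p.getVert j) ∧
    (∀ i j, i < j → j ≤ p.length → (G.Adj (p.getVert i) (p.getVert j) ↔ j = i + 1)) := by
  have hinj : ∀ i j, i ≤ p.length → j ≤ p.length → p.getVert i = p.getVert j → i = j :=
    fun i j hi hj h => hp.1.getVert_injOn hi hj h
  refine ⟨fun i j hij hj h => by have := hinj i j (by omega) hj h; omega, ?_⟩
  intro i j hij hj
  constructor
  · intro h
    have := hp.2 _ _ (Walk.getVert_mem_support _ _) (Walk.getVert_mem_support _ _) h
    rw [Walk.toSubgraph_adj_iff] at this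
    obtain ⟨k, hk, hkl⟩ := this
    rw [Sym2.eq_iff] at hk
    rcases hk with ⟨h1, h2⟩ | ⟨h1, h2⟩
    · have := hinj k i (by omega) (by omega) h1
      have := hinj (k+1) j (by omega) (by omega) h2
      omega
    · have := hinj k j (by omega) (by omega) h1
      have := hinj (k+1) i (by omega) (by omega) h2
      omega
  · rintro rfl
    exact p.adj_getVert_succ (by omega)

lemma indOfShort {V : Type*} [DecidableEq V] (G : SimpleGraph V) {u v : V} (p : G.Walk u v)
    (hp : p.IsPath)
    (hs : ∀ q : G.Walk u v, q.IsPath → (∀ x ∈ q.support, x ∈ p.support) → p.length ≤ q.length) :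
    IsInducedPathW G p := by
  have key : ∀ i j, i < j → j ≤ p.length → G.Adj (p.getVert i) (p.getVert j) → j = i + 1 := by
    intro i j hij hj h
    by_contra hne
    have := hs (((p.take i).append (Walk.cons h (p.drop j))).bypass) (Walk.bypass_isPath _) (by
      intro x hx
      have hx := Walk.support_bypass_subset_support _ hx
      rw [Walk.mem_support_append_iff, Walk.support_cons, List.mem_cons] at hx
      rcases hx with hx | hx | hx
      · exact (Walk.isSubwalk_take p i).support_subset hx
      · rw [hx]; exact Walk.getVert_mem_support _ _
      · exact (Walk.isSubwalk_drop p j).support_subset hx)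
    have h2 := Walk.length_bypass_le_length ((p.take i).append (Walk.cons h (p.drop j)))
    simp at h2
    omega
  refine ⟨hp, ?_⟩
  intro x y hx hy hxy
  obtain ⟨i, rfl, hi⟩ := Walk.mem_support_iff_exists_getVert.1 hx
  obtain ⟨j, rfl, hj⟩ := Walk.mem_support_iff_exists_getVert.1 hy
  rw [Walk.toSubgraph_adj_iff]
  rcases lt_trichotomy i j with h | h | h
  · have := key i j h hj hxy
    subst this
    exact ⟨i, rfl, by omega⟩
  · subst h; exact absurd hxy (G.loopless.irrefl _)
  · have := key j i h hi hxy.symm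
    subst this
    exact ⟨j, Sym2.eq_swap, by omega⟩

/-- Core case analysis. -/
lemma core {V : Type*} [DecidableEq V] (G : SimpleGraph V) (q r : ℕ → V) (n k : ℕ)
    (hqi : ∀ i j, i < j → j ≤ n → q i ≠ q j)
    (hq : ∀ i j, i < j → j ≤ n → (G.Adj (q i) (q j) ↔ j = i + 1 ∨ (i = 0 ∧ j = n)))
    (hri : ∀ i j, i < j → j ≤ k → r i ≠ r j)
    (hr : ∀ i j, i < j → j ≤ k → (G.Adj (r i) (r j) ↔ j = i + 1))
    (hrqi : ∀ i j, i ≤ k → j ≤ n → r i ≠ q j)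
    (hrq : ∀ i j, i < k → j ≤ n → (G.Adj (r i) (q j) ↔ i = 0 ∧ (j = 0 ∨ j = n)))
    (hk : 1 ≤ k) (hn : 3 ≤ n)
    (h0 : ¬ G.Adj (r k) (q 0)) (h1 : ¬ G.Adj (r k) (q n))
    (hex : ∃ j ≤ n, G.Adj (r k) (q j))
    (W : Finset V) (hW : ∀ x, x ∈ W ↔ (∃ i ≤ k, x = r i) ∨ (∃ i ≤ n, x = q i)) :
    (HasPyramidOn G W ∧ ∃ j, ∀ i ≤ n, G.Adj (r k) (q i) → i = j) ∨ HasPrismOn G W ∨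
      ∃ S, S ⊂ W ∧ HasPyramidOn G S := by
  classical
  obtain ⟨j, ⟨hjn, hj⟩, hjmin⟩ : ∃ j, (j ≤ n ∧ G.Adj (r k) (q j)) ∧
      ∀ i ≤ n, G.Adj (r k) (q i) → j ≤ i :=
    ⟨Nat.find hex, Nat.find_spec hex, fun i hi h => Nat.find_min' hex ⟨hi, h⟩⟩
  obtain ⟨j', ⟨hjn', hj'⟩, hjmax⟩ : ∃ j, (j ≤ n ∧ G.Adj (r k) (q j)) ∧
      ∀ i ≤ n, G.Adj (r k) (q i) → i ≤ j := by
    have h := Nat.findGreatest_spec (P := fun i => G.Adj (r k) (q i)) hjn hj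
    exact ⟨_, ⟨Nat.findGreatest_le n, h⟩, fun i hi h => Nat.le_findGreatest hi h⟩
  have hj0 : j ≠ 0 := by rintro rfl; exact h0 hj
  have hjn'' : j' ≠ n := by rintro rfl; exact h1 hj'
  have hjj := hjmin _ hjn' hj'
  have hqi' : ∀ i j, i ≤ n → j ≤ n → q i = q j → i = j := by
    intro i j hi hj h
    rcases lt_trichotomy i j with h' | h' | h'
    · exact absurd h (hqi _ _ h' hj)
    · exact h'
    · exact absurd h.symm (hqi _ _ h' hi)
  have hri' : ∀ i j, i ≤ k → j ≤ k → r i = r j → i = j := by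
    intro i j hi hj h
    rcases lt_trichotomy i j with h' | h' | h'
    · exact absurd h (hri _ _ h' hj)
    · exact h'
    · exact absurd h.symm (hri _ _ h' hi)
  have hq' : ∀ i j, i ≤ n → j ≤ n → G.Adj (q i) (q j) →
      j = i + 1 ∨ i = j + 1 ∨ (i = 0 ∧ j = n) ∨ (j = 0 ∧ i = n) := by
    intro i j hi hj h
    rcases lt_trichotomy i j with h' | h' | h'
    · rcases (hq _ _ h' hj).1 h with h | h <;> omega
    · subst h'; exact absurd h (G.loopless.irrefl _)
    · rcases (hq _ _ h' hi).1 h.symm with h | h <;> omega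
  have hb12 : G.Adj (r 0) (q 0) := (hrq 0 0 (by omega) (by omega)).2 (by omega)
  have hb13 : G.Adj (r 0) (q n) := (hrq 0 n (by omega) (by omega)).2 (by omega)
  have hb23 : G.Adj (q 0) (q n) := (hq 0 n (by omega) (by omega)).2 (by omega)
  have down : ∀ i ≤ n - 1, ∃ p : G.Walk (q i) (q 0), IsInducedPathW G p ∧
      ∀ x, x ∈ p.support ↔ ∃ s ≤ i, x = q s := by
    intro i hi
    obtain ⟨p, hp, hs⟩ := mkInd G i (fun s => q (i - s)) (q i) (q 0) (by simp) (by simp)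
      (fun s t hst ht h => by have := hqi' _ _ (by omega) (by omega) h; omega)
      (fun s t hst ht => by
        rw [G.adj_comm, hq _ _ (by omega) (by omega)]; omega)
    refine ⟨p, hp, fun x => (hs x).trans ⟨?_, ?_⟩⟩
    · rintro ⟨s, hs, rfl⟩; exact ⟨i - s, by omega, rfl⟩
    · rintro ⟨s, hs, rfl⟩; exact ⟨i - s, by omega, by congr; omega⟩
  have up : ∀ i ≤ n, 1 ≤ i → ∃ p : G.Walk (q i) (q n), IsInducedPathW G p ∧
      ∀ x, x ∈ p.support ↔ ∃ s ≤ n, i ≤ s ∧ x = q s := by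
    intro i hi hi1
    obtain ⟨p, hp, hs⟩ := mkInd G (n - i) (fun s => q (i + s)) (q i) (q n) (by simp)
      (by congr; omega)
      (fun s t hst ht h => by have := hqi' _ _ (by omega) (by omega) h; omega)
      (fun s t hst ht => by
        rw [hq _ _ (by omega) (by omega)]; omega)
    refine ⟨p, hp, fun x => (hs x).trans ⟨?_, ?_⟩⟩
    · rintro ⟨s, hs, rfl⟩; exact ⟨i + s, by omega, by omega, rfl⟩
    · rintro ⟨s, hs, hs', rfl⟩; exact ⟨s - i, by omega, by congr; omega⟩
  have rdown : ∃ p : G.Walk (r k) (r 0), IsInducedPathW G p ∧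
      ∀ x, x ∈ p.support ↔ ∃ s ≤ k, x = r s := by
    obtain ⟨p, hp, hs⟩ := mkInd G k (fun s => r (k - s)) (r k) (r 0) (by simp) (by simp)
      (fun s t hst ht h => by have := hri' _ _ (by omega) (by omega) h; omega)
      (fun s t hst ht => by
        rw [G.adj_comm, hr _ _ (by omega) (by omega)]; omega)
    refine ⟨p, hp, fun x => (hs x).trans ⟨?_, ?_⟩⟩
    · rintro ⟨s, hs, rfl⟩; exact ⟨k - s, by omega, rfl⟩
    · rintro ⟨s, hs, rfl⟩; exact ⟨k - s, by omega, by congr; omega⟩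
  have ext_path : ∀ (c u v : V) (p : G.Walk u v), IsInducedPathW G p → G.Adj c u →
      (∀ x ∈ p.support, c ≠ x) → (∀ x ∈ p.support, G.Adj c x → x = u) →
      ∃ p' : G.Walk c v, IsInducedPathW G p' ∧ ∀ x, x ∈ p'.support ↔ x = c ∨ x ∈ p.support := by
    intro c u v p hp hcu hne hadj
    refine ⟨Walk.cons hcu p, ⟨?_, ?_⟩, by simp⟩
    · rw [Walk.cons_isPath_iff]
      exact ⟨hp.1, fun h => hne c h rfl⟩
    · intro x y hx hy hxy
      rw [Walk.support_cons, List.mem_cons] at hx hy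
      simp only [Walk.toSubgraph, Subgraph.sup_adj, subgraphOfAdj_adj]
      rcases hx with rfl | hx <;> rcases hy with rfl | hy
      · exact absurd hxy (G.loopless.irrefl _)
      · left; rw [hadj y hy hxy]
      · left; rw [hadj x hx hxy.symm, Sym2.eq_swap]
      · right; exact hp.2 x y hx hy hxy
  obtain ⟨T, hT, hTs⟩ := rdown
  obtain ⟨D, hD, hDs⟩ := down j (by omega)
  obtain ⟨U, hU, hUs⟩ := up j' (by omega) (by omega)
  rcases Nat.lt_or_ge (j + 1) j' with hc | hc
  · right; right
    obtain ⟨D', hD', hDs'⟩ := ext_path (r k) _ _ D hD hj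
      (by intro x hx; obtain ⟨s, hs, rfl⟩ := (hDs x).1 hx; exact hrqi _ _ le_rfl (by omega))
      (by
        intro x hx h; obtain ⟨s, hs, rfl⟩ := (hDs x).1 hx
        have := hjmin s (by omega) h
        congr; omega)
    obtain ⟨U', hU', hUs'⟩ := ext_path (r k) _ _ U hU hj'
      (by intro x hx; obtain ⟨s, hs, _, rfl⟩ := (hUs x).1 hx; exact hrqi _ _ le_rfl (by omega))
      (by
        intro x hx h; obtain ⟨s, hs, _, rfl⟩ := (hUs x).1 hx
        have := hjmax s (by omega) h
        congr; omega)
    refine ⟨T.support.toFinset ∪ D'.support.toFinset ∪ U'.support.toFinset, ?_,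
      _, _, _, _, T, D', U', ⟨hT, hD', hU', hb12, hb23, hb13, fun h => h0 h.2, fun h => h1 h.2,
        fun h => h1 h.2, ⟨?_, ?_⟩, ⟨?_, ?_⟩, ⟨?_, ?_⟩⟩, rfl⟩
    · rw [Finset.ssubset_iff]
      refine ⟨q (j+1), ?_, ?_⟩
      · simp only [Finset.mem_union, List.mem_toFinset, hTs, hDs', hUs', hDs, hUs]
        rintro (⟨⟨i, hi, h⟩ | h | ⟨i, hi, h⟩⟩ | h | ⟨i, hi, hi', h⟩)
        · exact hrqi _ _ hi (by omega) h.symm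
        · exact hrqi _ _ le_rfl (by omega) h.symm
        · have := hqi' _ _ (by omega) (by omega) h; omega
        · exact hrqi _ _ le_rfl (by omega) h.symm
        · have := hqi' _ _ (by omega) (by omega) h; omega
      · intro x hx
        simp only [Finset.mem_insert, Finset.mem_union, List.mem_toFinset, hTs, hDs', hUs', hDs, hUs] at hx
        rw [hW]
        rcases hx with h | ⟨⟨i, hi, h⟩ | h | ⟨i, hi, h⟩⟩ | h | ⟨i, hi, hi', h⟩
        · exact Or.inr ⟨_, by omega, h⟩
        · exact Or.inl ⟨_, hi, h⟩
        · exact Or.inl ⟨_, le_rfl, h⟩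
        · exact Or.inr ⟨_, by omega, h⟩
        · exact Or.inl ⟨_, le_rfl, h⟩
        · exact Or.inr ⟨_, by omega, h⟩
    · intro x hx hy
      obtain ⟨i, hi, rfl⟩ := (hTs x).1 hx
      rcases (hDs' _).1 hy with h | h
      · exact h
      · obtain ⟨s, hs, h⟩ := (hDs _).1 h
        exact absurd h (hrqi _ _ hi (by omega))
    · intro x hx y hy hxa hya h
      obtain ⟨i, hi, rfl⟩ := (hTs x).1 hx
      rcases (hDs' _).1 hy with h' | h'
      · exact absurd h' hya
      · obtain ⟨s, hs, rfl⟩ := (hDs _).1 h'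
        have hik : i ≠ k := by rintro rfl; exact hxa rfl
        obtain ⟨rfl, h⟩ := (hrq i s (by omega) (by omega)).1 h
        exact ⟨rfl, by congr; omega⟩
    · intro x hx hy
      obtain ⟨i, hi, rfl⟩ := (hTs x).1 hx
      rcases (hUs' _).1 hy with h | h
      · exact h
      · obtain ⟨s, hs, _, h⟩ := (hUs _).1 h
        exact absurd h (hrqi _ _ hi (by omega))
    · intro x hx y hy hxa hya h
      obtain ⟨i, hi, rfl⟩ := (hTs x).1 hx
      rcases (hUs' _).1 hy with h' | h'
      · exact absurd h' hya
      · obtain ⟨s, hs, _, rfl⟩ := (hUs _).1 h'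
        have hik : i ≠ k := by rintro rfl; exact hxa rfl
        obtain ⟨rfl, h⟩ := (hrq i s (by omega) (by omega)).1 h
        exact ⟨rfl, by congr; omega⟩
    · intro x hx hy
      rcases (hDs' _).1 hx with h | h
      · exact h
      rcases (hUs' _).1 hy with h' | h'
      · exact h'
      obtain ⟨s, hs, rfl⟩ := (hDs _).1 h
      obtain ⟨t, ht, _, h⟩ := (hUs _).1 h'
      have := hqi' _ _ (by omega) (by omega) h; omega
    · intro x hx y hy hxa hya h
      rcases (hDs' _).1 hx with h' | hx
      · exact absurd h' hxa
      rcases (hUs' _).1 hy with h' | hy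
      · exact absurd h' hya
      obtain ⟨s, hs, rfl⟩ := (hDs _).1 hx
      obtain ⟨t, ht, _, rfl⟩ := (hUs _).1 hy
      have := hq' _ _ (by omega) (by omega) h
      exact ⟨by congr; omega, by congr; omega⟩
  rcases Nat.lt_or_ge j j' with hc' | hc'
  · have hjs : j' = j + 1 := by omega
    right; left
    refine ⟨_, _, _, _, _, _, T, D, U, ⟨hT, hD, hU, hj, ?_, hj', hb12, hb23, hb13, ?_, ?_, ?_,
      ⟨?_, ?_⟩, ⟨?_, ?_⟩, ⟨?_, ?_⟩⟩, ?_⟩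
    · exact (hq _ _ hc' hjn').2 (Or.inl hjs)
    · exact fun h => by have := hri' _ _ (by omega) (by omega) h; omega
    · exact fun h => by have := hqi' _ _ (by omega) (by omega) h; omega
    · exact fun h => by have := hqi' _ _ (by omega) (by omega) h; omega
    · intro x hx hy
      obtain ⟨i, hi, rfl⟩ := (hTs x).1 hx
      obtain ⟨s, hs, h⟩ := (hDs _).1 hy
      exact absurd h (hrqi _ _ hi (by omega))
    · intro x hx y hy h
      obtain ⟨i, hi, rfl⟩ := (hTs x).1 hx
      obtain ⟨s, hs, rfl⟩ := (hDs _).1 hy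
      rcases Nat.lt_or_ge i k with hik | hik
      · obtain ⟨rfl, h⟩ := (hrq i s (by omega) (by omega)).1 h
        exact Or.inr ⟨rfl, by congr; omega⟩
      · have : i = k := by omega
        subst this
        have := hjmin _ (by omega) h
        exact Or.inl ⟨rfl, by congr; omega⟩
    · intro x hx hy
      obtain ⟨i, hi, rfl⟩ := (hTs x).1 hx
      obtain ⟨s, hs, _, h⟩ := (hUs _).1 hy
      exact absurd h (hrqi _ _ hi (by omega))
    · intro x hx y hy h
      obtain ⟨i, hi, rfl⟩ := (hTs x).1 hx
      obtain ⟨s, hs, _, rfl⟩ := (hUs _).1 hy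
      rcases Nat.lt_or_ge i k with hik | hik
      · obtain ⟨rfl, h⟩ := (hrq i s (by omega) (by omega)).1 h
        exact Or.inr ⟨rfl, by congr; omega⟩
      · have : i = k := by omega
        subst this
        have := hjmax _ (by omega) h
        exact Or.inl ⟨rfl, by congr; omega⟩
    · intro x hx hy
      obtain ⟨s, hs, rfl⟩ := (hDs _).1 hx
      obtain ⟨t, ht, _, h⟩ := (hUs _).1 hy
      have := hqi' _ _ (by omega) (by omega) h; omega
    · intro x hx y hy h
      obtain ⟨s, hs, rfl⟩ := (hDs _).1 hx
      obtain ⟨t, ht, _, rfl⟩ := (hUs _).1 hy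
      have := hq' _ _ (by omega) (by omega) h
      rcases this with h | h | h | h
      · exact Or.inl ⟨by congr; omega, by congr; omega⟩
      · omega
      · exact Or.inr ⟨by congr; omega, by congr; omega⟩
      · omega
    · ext x
      simp only [Finset.mem_union, List.mem_toFinset, hTs, hDs, hUs, hW, or_assoc]
      refine or_congr Iff.rfl ⟨?_, ?_⟩
      · rintro (⟨i, hi, h⟩ | ⟨i, hi, _, h⟩)
        · exact ⟨i, by omega, h⟩
        · exact ⟨i, by omega, h⟩
      · rintro ⟨i, hi, h⟩
        rcases Nat.lt_or_ge j i with h' | h'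
        · exact Or.inr ⟨i, hi, by omega, h⟩
        · exact Or.inl ⟨i, by omega, h⟩
  · have hjs : j' = j := by omega
    subst hjs
    left
    obtain ⟨T', hT', hTs'⟩ := ext_path (q j') _ _ T hT hj'.symm
      (by intro x hx h; obtain ⟨s, hs, rfl⟩ := (hTs x).1 hx
          exact hrqi _ _ hs (by omega) h.symm)
      (by
        intro x hx h; obtain ⟨s, hs, rfl⟩ := (hTs x).1 hx
        by_contra hne
        have hsk : s ≠ k := by rintro rfl; exact hne rfl
        have := (hrq _ _ (by omega) (by omega)).1 h.symm
        omega)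
    refine ⟨⟨_, _, _, _, T', D, U, ⟨hT', hD, hU, hb12, hb23, hb13, ?_, ?_, ?_,
      ⟨?_, ?_⟩, ⟨?_, ?_⟩, ⟨?_, ?_⟩⟩, ?_⟩,
      j', fun i hi h => le_antisymm (hjmax i hi h) (hjmin i hi h)⟩
    · rintro ⟨h, -⟩
      have := (hrq _ _ (by omega) (by omega)).1 h.symm
      omega
    · rintro ⟨h, -⟩
      have := (hrq _ _ (by omega) (by omega)).1 h.symm
      omega
    · rintro ⟨h, h'⟩
      have := hq' _ _ (by omega) (by omega) h
      have := hq' _ _ (by omega) (by omega) h'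
      omega
    · intro x hx hy
      rcases (hTs' _).1 hx with h | h
      · exact h
      obtain ⟨i, hi, rfl⟩ := (hTs x).1 h
      obtain ⟨s, hs, h⟩ := (hDs _).1 hy
      exact absurd h (hrqi _ _ hi (by omega))
    · intro x hx y hy hxa hya h
      rcases (hTs' _).1 hx with h' | h'
      · exact absurd h' hxa
      obtain ⟨i, hi, rfl⟩ := (hTs x).1 h'
      obtain ⟨s, hs, rfl⟩ := (hDs _).1 hy
      have hik : i ≠ k := by
        rintro rfl
        have := hjmin _ (by omega) h
        exact hya (by congr; omega)
      obtain ⟨rfl, h⟩ := (hrq i s (by omega) (by omega)).1 h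
      exact ⟨rfl, by congr; omega⟩
    · intro x hx hy
      rcases (hTs' _).1 hx with h | h
      · exact h
      obtain ⟨i, hi, rfl⟩ := (hTs x).1 h
      obtain ⟨s, hs, _, h⟩ := (hUs _).1 hy
      exact absurd h (hrqi _ _ hi (by omega))
    · intro x hx y hy hxa hya h
      rcases (hTs' _).1 hx with h' | h'
      · exact absurd h' hxa
      obtain ⟨i, hi, rfl⟩ := (hTs x).1 h'
      obtain ⟨s, hs, _, rfl⟩ := (hUs _).1 hy
      have hik : i ≠ k := by
        rintro rfl
        have := hjmax _ (by omega) h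
        exact hya (by congr; omega)
      obtain ⟨rfl, h⟩ := (hrq i s (by omega) (by omega)).1 h
      exact ⟨rfl, by congr; omega⟩
    · intro x hx hy
      obtain ⟨s, hs, rfl⟩ := (hDs _).1 hx
      obtain ⟨t, ht, _, h⟩ := (hUs _).1 hy
      have := hqi' _ _ (by omega) (by omega) h
      congr; omega
    · intro x hx y hy hxa hya h
      obtain ⟨s, hs, rfl⟩ := (hDs _).1 hx
      obtain ⟨t, ht, _, rfl⟩ := (hUs _).1 hy
      have h1 : s ≠ j' := by rintro rfl; exact hxa rfl
      have h2 : t ≠ j' := by rintro rfl; exact hya rfl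
      have := hq' _ _ (by omega) (by omega) h
      exact ⟨by congr; omega, by congr; omega⟩
    · ext x
      simp only [Finset.mem_union, List.mem_toFinset, hTs', hTs, hDs, hUs, hW]
      constructor
      · rintro (((h | h) | ⟨i, hi, h⟩) | ⟨i, hi, _, h⟩)
        · exact Or.inr ⟨_, by omega, h⟩
        · exact Or.inl h
        · exact Or.inr ⟨i, by omega, h⟩
        · exact Or.inr ⟨i, by omega, h⟩
      · rintro (h | ⟨i, hi, h⟩)
        · exact Or.inl (Or.inl (Or.inr h))
        rcases Nat.lt_or_ge j' i with h' | h'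
        · exact Or.inr ⟨i, hi, by omega, h⟩
        · exact Or.inl (Or.inr ⟨i, by omega, h⟩)

/-- If `K` is a smallest induced pyramid or prism of `G` and `K` is a
pyramid formed by `P₁, P₂, P₃` with triangle `{b₁,b₂,b₃}` and apex `a`, and `R₁` is a
shortest path from `b₁` to `a` whose interior vertices are not adjacent to `b₂` or `b₃`,
then `V(R₁) ∪ V(P₂) ∪ V(P₃)` induces a smallest pyramid or prism of `G`. -/
theorem smallest_pyramid_replace_leg
    {V : Type*} [Fintype V] [DecidableEq V] (G : SimpleGraph V)
    (a b₁ b₂ b₃ : V) (P₁ : G.Walk a b₁) (P₂ : G.Walk a b₂) (P₃ : G.Walk a b₃)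
    (hK : IsPyramid G a b₁ b₂ b₃ P₁ P₂ P₃)
    (hKmin : ∀ S : Finset V, HasPyramidOn G S ∨ HasPrismOn G S →
      (P₁.support.toFinset ∪ P₂.support.toFinset ∪ P₃.support.toFinset).card ≤ S.card)
    (R₁ : G.Walk b₁ a) (hR₁ : R₁.IsPath)
    (hR₁int : ∀ x ∈ R₁.support, x ≠ b₁ → x ≠ a → ¬ G.Adj x b₂ ∧ ¬ G.Adj x b₃)
    (hR₁short : ∀ Q : G.Walk b₁ a, Q.IsPath →
      (∀ x ∈ Q.support, x ≠ b₁ → x ≠ a → ¬ G.Adj x b₂ ∧ ¬ G.Adj x b₃) →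
      R₁.length ≤ Q.length) :
    (HasPyramidOn G (R₁.support.toFinset ∪ P₂.support.toFinset ∪ P₃.support.toFinset) ∨
      HasPrismOn G (R₁.support.toFinset ∪ P₂.support.toFinset ∪ P₃.support.toFinset)) ∧
    ∀ S : Finset V, HasPyramidOn G S ∨ HasPrismOn G S →
      (R₁.support.toFinset ∪ P₂.support.toFinset ∪ P₃.support.toFinset).card ≤ S.card := by
  classical
  obtain ⟨hP1, hP2, hP3, h12, h23, h13, ha12, ha13, ha23, pp12, pp13, pp23⟩ := hK
  have hab1 : a ≠ b₁ := by rintro rfl; exact ha23 ⟨h12, h13⟩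
  have hab2 : a ≠ b₂ := by rintro rfl; exact ha13 ⟨h12.symm, h23⟩
  have hab3 : a ≠ b₃ := by rintro rfl; exact ha12 ⟨h13.symm, h23.symm⟩
  have hRle : R₁.length ≤ P₁.length := by
    have := hR₁short P₁.reverse hP1.1.reverse (by
      intro x hx hxb hxa
      rw [Walk.support_reverse, List.mem_reverse] at hx
      exact ⟨fun h => hxb (pp12.2 x hx _ P₂.end_mem_support hxa hab2.symm h).1,
        fun h => hxb (pp13.2 x hx _ P₃.end_mem_support hxa hab3.symm h).1⟩)
    simpa using this
  have hRind : IsInducedPathW G R₁ := indOfShort G R₁ hR₁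
    (fun Q hQ hs => hR₁short Q hQ (fun x hx => hR₁int x (hs x hx)))
  obtain ⟨i2, e2⟩ := ofInd G P₂ hP2
  obtain ⟨i3, e3⟩ := ofInd G P₃ hP3
  obtain ⟨iR, eR⟩ := ofInd G R₁ hRind
  have hα : 1 ≤ P₂.length := by
    by_contra h
    exact hab2 (Walk.eq_of_length_eq_zero (p := P₂) (by omega))
  have hβ : 1 ≤ P₃.length := by
    by_contra h
    exact hab3 (Walk.eq_of_length_eq_zero (p := P₃) (by omega))
  have hn3 : 3 ≤ P₂.length + P₃.length := by
    by_contra h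
    exact ha23 ⟨Walk.adj_of_length_eq_one (p := P₂) (by omega),
      Walk.adj_of_length_eq_one (p := P₃) (by omega)⟩
  obtain ⟨α, hαe⟩ : ∃ α, P₂.length = α := ⟨_, rfl⟩
  obtain ⟨β, hβe⟩ : ∃ β, P₃.length = β := ⟨_, rfl⟩
  obtain ⟨m, hme⟩ : ∃ m, R₁.length = m := ⟨_, rfl⟩
  rw [hαe] at i2 e2 hα hn3
  rw [hβe] at i3 e3 hβ hn3
  rw [hme] at iR eR hRle
  obtain ⟨q, hqlo, hqhi⟩ : ∃ q : ℕ → V, (∀ i ≤ α, q i = P₂.getVert (α - i)) ∧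
      (∀ i, α ≤ i → q i = P₃.getVert (i - α)) := by
    refine ⟨fun i => if i ≤ α then P₂.getVert (α - i) else P₃.getVert (i - α), ?_, ?_⟩
    · intro i hi; simp [hi]
    · intro i hi
      by_cases h : i = α
      · subst h; simp
      · have : ¬ i ≤ α := by omega
        simp [this]
  have hg2 : P₂.getVert α = b₂ := by rw [← hαe]; simp
  have hg3 : P₃.getVert β = b₃ := by rw [← hβe]; simp
  have hgm : R₁.getVert m = a := by rw [← hme]; simp
  have q0 : q 0 = b₂ := by rw [hqlo 0 (by omega)]; simpa using hg2
  have qa : q α = a := by rw [hqlo α le_rfl]; simp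
  have qn : q (α + β) = b₃ := by rw [hqhi _ (by omega)]; simpa using hg3
  have hm2 : ∀ i ≤ α, q i ∈ P₂.support := fun i hi => by
    rw [hqlo i hi]; exact Walk.getVert_mem_support _ _
  have hm3 : ∀ i, α ≤ i → q i ∈ P₃.support := fun i hi => by
    rw [hqhi i hi]; exact Walk.getVert_mem_support _ _
  have hqilo : ∀ i j, i < j → j ≤ α → q i ≠ q j := by
    intro i j hij hj
    rw [hqlo i (by omega), hqlo j hj]
    exact (i2 _ _ (by omega) (by omega)).symm
  have hqihi : ∀ i j, i < j → α ≤ i → j ≤ α + β → q i ≠ q j := by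
    intro i j hij hi hj
    rw [hqhi i (by omega), hqhi j (by omega)]
    exact (i3 _ _ (by omega) (by omega))
  have hqne : ∀ i ≤ α + β, i ≠ α → q i ≠ a := by
    intro i hi hne
    rw [← qa]
    rcases Nat.lt_or_ge i α with h | h
    · exact hqilo _ _ h le_rfl
    · exact (hqihi _ _ (by omega) le_rfl hi).symm
  have hqi : ∀ i j, i < j → j ≤ α + β → q i ≠ q j := by
    intro i j hij hj h
    by_cases h1 : j ≤ α
    · exact hqilo i j hij h1 h
    by_cases h2 : α ≤ i
    · exact hqihi i j hij h2 hj h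
    have := pp23.1 (q i) (hm2 i (by omega)) (by rw [h]; exact hm3 j (by omega))
    exact hqne i (by omega) (by omega) this
  have hqi' : ∀ i j, i ≤ α + β → j ≤ α + β → q i = q j → i = j := by
    intro i j hi hj h
    rcases lt_trichotomy i j with h' | h' | h'
    · exact absurd h (hqi _ _ h' hj)
    · exact h'
    · exact absurd h.symm (hqi _ _ h' hi)
  have hq : ∀ i j, i < j → j ≤ α + β →
      (G.Adj (q i) (q j) ↔ j = i + 1 ∨ (i = 0 ∧ j = α + β)) := by
    intro i j hij hj
    by_cases h1 : j ≤ α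
    · rw [hqlo i (by omega), hqlo j h1, G.adj_comm, e2 _ _ (by omega) (by omega)]
      omega
    by_cases h2 : α ≤ i
    · rw [hqhi i (by omega), hqhi j (by omega), e3 _ _ (by omega) (by omega)]
      omega
    constructor
    · intro h
      obtain ⟨h3, h4⟩ := pp23.2 _ (hm2 i (by omega)) _ (hm3 j (by omega))
        (hqne i (by omega) (by omega)) (hqne j (by omega) (by omega)) h
      rw [← q0] at h3
      rw [← qn] at h4
      have := hqi' _ _ (by omega) (by omega) h3
      have := hqi' _ _ (by omega) (by omega) h4
      omega
    · rintro (h | ⟨rfl, rfl⟩)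
      · omega
      · rw [q0, qn]; exact h23
  have hmem : ∀ x, (x ∈ P₂.support ∨ x ∈ P₃.support) ↔ ∃ i ≤ α + β, x = q i := by
    intro x
    constructor
    · rintro (h | h)
      · obtain ⟨i, rfl, hi⟩ := Walk.mem_support_iff_exists_getVert.1 h
        exact ⟨α - i, by omega, by rw [hqlo _ (by omega)]; congr; omega⟩
      · obtain ⟨i, rfl, hi⟩ := Walk.mem_support_iff_exists_getVert.1 h
        exact ⟨α + i, by omega, by rw [hqhi _ (by omega)]; congr; omega⟩
    · rintro ⟨i, hi, rfl⟩
      rcases Nat.lt_or_ge i α with h | h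
      · exact Or.inl (hm2 i h.le)
      · exact Or.inr (hm3 i h)
  have hHcard : (P₂.support.toFinset ∪ P₃.support.toFinset).card = α + β + 1 := by
    have : P₂.support.toFinset ∪ P₃.support.toFinset = (Finset.range (α + β + 1)).image q := by
      ext x
      simp only [Finset.mem_union, List.mem_toFinset, hmem, Finset.mem_image, Finset.mem_range]
      constructor
      · rintro ⟨i, hi, rfl⟩; exact ⟨i, by omega, rfl⟩
      · rintro ⟨i, hi, rfl⟩; exact ⟨i, by omega, rfl⟩
    rw [this, Finset.card_image_of_injOn, Finset.card_range]
    intro i hi j hj h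
    simp only [Finset.coe_range, Set.mem_Iio] at hi hj
    exact hqi' _ _ (by omega) (by omega) h
  have hKcard : (P₁.support.toFinset ∪ P₂.support.toFinset ∪ P₃.support.toFinset).card
      = P₁.length + (α + β + 1) := by
    have : P₁.support.toFinset ∪ P₂.support.toFinset ∪ P₃.support.toFinset =
        (P₁.support.toFinset.erase a) ∪ (P₂.support.toFinset ∪ P₃.support.toFinset) := by
      ext x
      have := P₂.start_mem_support
      simp only [Finset.mem_union, List.mem_toFinset, Finset.mem_erase]
      by_cases hx : x = a
      · subst hx; simp
      · simp [hx, or_assoc]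
    rw [this, Finset.card_union_of_disjoint, hHcard, Finset.card_erase_of_mem (by simp),
      List.toFinset_card_of_nodup hP1.1.support_nodup, Walk.length_support]
    · rfl
    · rw [Finset.disjoint_left]
      intro x hx hx'
      simp only [Finset.mem_union, List.mem_toFinset, Finset.mem_erase] at hx hx'
      rcases hx' with h | h
      · exact hx.1 (pp12.1 x hx.2 h)
      · exact hx.1 (pp13.1 x hx.2 h)
  have hRcard : (R₁.support.toFinset ∪ P₂.support.toFinset ∪ P₃.support.toFinset).card
      ≤ P₁.length + (α + β + 1) := by
    have : R₁.support.toFinset ∪ P₂.support.toFinset ∪ P₃.support.toFinset =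
        (R₁.support.toFinset.erase a) ∪ (P₂.support.toFinset ∪ P₃.support.toFinset) := by
      ext x
      have := P₂.start_mem_support
      simp only [Finset.mem_union, List.mem_toFinset, Finset.mem_erase]
      by_cases hx : x = a
      · subst hx; simp
      · simp [hx, or_assoc]
    rw [this]
    refine (Finset.card_union_le _ _).trans ?_
    rw [hHcard, Finset.card_erase_of_mem (by simp),
      List.toFinset_card_of_nodup hR₁.support_nodup, Walk.length_support]
    omega
  refine ⟨?_, fun S hS => hRcard.trans (hKcard ▸ hKmin S hS)⟩
  have qam : q α = R₁.getVert m := qa.trans hgm.symm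
  have hb1 : ∀ j ≤ α + β, j ≠ α → (G.Adj b₁ (q j) ↔ j = 0 ∨ j = α + β) := by
    intro j hj hne
    constructor
    · intro h
      rcases Nat.lt_or_ge j α with h' | h'
      · have := (pp12.2 _ P₁.end_mem_support _ (hm2 j h'.le) hab1.symm (hqne j hj hne) h).2
        rw [← q0] at this
        exact Or.inl (hqi' _ _ hj (by omega) this)
      · have := (pp13.2 _ P₁.end_mem_support _ (hm3 j h') hab1.symm (hqne j hj hne) h).2
        rw [← qn] at this
        exact Or.inr (hqi' _ _ hj (by omega) this)
    · rintro (rfl | rfl)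
      · rw [q0]; exact h12
      · rw [qn]; exact h13
  have hb1q : ∀ j ≤ α + β, b₁ ≠ q j := by
    intro j hj h
    rcases Nat.lt_or_ge j α with h' | h'
    · exact hab1 (pp12.1 _ P₁.end_mem_support (by rw [h]; exact hm2 j h'.le)).symm
    · exact hab1 (pp13.1 _ P₁.end_mem_support (by rw [h]; exact hm3 j h')).symm
  have hRne : ∀ i, i < m → R₁.getVert i ≠ a := by
    intro i hi
    exact fun h => iR _ _ hi le_rfl (h.trans hgm.symm)
  have hRneb : ∀ i, 0 < i → i ≤ m → R₁.getVert i ≠ b₁ := by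
    intro i hi him h
    exact iR 0 i hi him (by simpa using h.symm)
  have hRint : ∀ i, 0 < i → i < m → ¬ G.Adj (R₁.getVert i) (q 0) ∧
      ¬ G.Adj (R₁.getVert i) (q (α + β)) := by
    intro i hi him
    rw [q0, qn]
    exact hR₁int _ (Walk.getVert_mem_support _ _) (hRneb i hi him.le) (hRne i him)
  by_cases hbad : ∃ k, 0 < k ∧ k < m ∧ ∃ j ≤ α + β, j ≠ α ∧ G.Adj (R₁.getVert k) (q j)
  · obtain ⟨k, ⟨hk0, hkm, j, hj, hjα, hkj⟩, hkmin⟩ : ∃ k, (0 < k ∧ k < m ∧ ∃ j ≤ α + β, j ≠ α ∧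
        G.Adj (R₁.getVert k) (q j)) ∧ ∀ i < k, ¬ (0 < i ∧ i < m ∧ ∃ j ≤ α + β, j ≠ α ∧
        G.Adj (R₁.getVert i) (q j)) :=
      ⟨Nat.find hbad, Nat.find_spec hbad, fun i hi => Nat.find_min hbad hi⟩
    have hnoa : ∀ i, i + 1 < m → ¬ G.Adj (R₁.getVert i) (q α) := by
      intro i hi h
      rw [qam, eR _ _ (by omega) le_rfl] at h
      omega
    have hrq : ∀ i j, i < k → j ≤ α + β →
        (G.Adj (R₁.getVert i) (q j) ↔ i = 0 ∧ (j = 0 ∨ j = α + β)) := by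
      intro i j hi hj
      by_cases hjα : j = α
      · subst hjα
        have := hnoa i (by omega)
        constructor
        · intro h; exact absurd h this
        · omega
      · rcases Nat.eq_zero_or_pos i with rfl | hi0
        · rw [Walk.getVert_zero, hb1 j hj hjα]; simp
        · constructor
          · intro h
            exact absurd ⟨hi0, by omega, j, hj, hjα, h⟩ (hkmin i hi)
          · omega
    have hrqi : ∀ i j, i ≤ k → j ≤ α + β → R₁.getVert i ≠ q j := by
      intro i j hi hj h
      rcases Nat.eq_zero_or_pos i with rfl | hi0
      · exact hb1q j hj (by simpa using h)
      · have hjα : j ≠ α := by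
          rintro rfl
          exact hRne i (by omega) (h.trans qa)
        have hadj : G.Adj (R₁.getVert (i - 1)) (R₁.getVert i) :=
          (eR _ _ (by omega) (by omega)).2 (by omega)
        rw [h, hrq _ _ (by omega) hj] at hadj
        have h1 := hRint i hi0 (by omega)
        rw [h] at h1
        have h0n : G.Adj (q 0) (q (α + β)) := (hq 0 _ (by omega) le_rfl).2 (by omega)
        rcases hadj.2 with rfl | rfl
        · exact h1.2 h0n
        · exact h1.1 h0n.symm
    have hcore := core G q R₁.getVert (α + β) k hqi hq
      (fun i j hij hj => iR i j hij (by omega)) (fun i j hij hj => eR i j hij (by omega))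
      hrqi hrq hk0 hn3 (hRint k hk0 hkm).1 (hRint k hk0 hkm).2 ⟨j, hj, hkj⟩
      ((Finset.range (k + 1)).image R₁.getVert ∪
        (P₂.support.toFinset ∪ P₃.support.toFinset)) (by
        intro x
        simp only [Finset.mem_union, List.mem_toFinset, hmem, Finset.mem_image, Finset.mem_range]
        refine or_congr ⟨?_, ?_⟩ Iff.rfl
        · rintro ⟨i, hi, rfl⟩; exact ⟨i, by omega, rfl⟩
        · rintro ⟨i, hi, rfl⟩; exact ⟨i, by omega, rfl⟩)
    have hWcard : ((Finset.range (k + 1)).image R₁.getVert ∪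
        (P₂.support.toFinset ∪ P₃.support.toFinset)).card ≤ (k + 1) + (α + β + 1) := by
      refine (Finset.card_union_le _ _).trans ?_
      rw [hHcard]
      have := Finset.card_image_le (s := Finset.range (k + 1)) (f := R₁.getVert)
      rw [Finset.card_range] at this
      omega
    rw [hKcard] at hKmin
    rcases hcore with ⟨hpyr, c, hc⟩ | hpri | ⟨S, hSW, hS⟩
    · exfalso
      have h1 := hKmin _ (Or.inl hpyr)
      have hkm' : k + 1 = m := by omega
      have h2 : G.Adj (R₁.getVert k) (q α) := by
        rw [qam, eR _ _ hkm le_rfl]; omega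
      have := hc α (by omega) h2
      have := hc j hj hkj
      omega
    · have h1 := hKmin _ (Or.inr hpri)
      have hkm' : k + 1 = m := by omega
      right
      convert hpri using 1
      ext x
      have ha := P₂.start_mem_support
      simp only [Finset.mem_union, List.mem_toFinset, Finset.mem_image, Finset.mem_range,
        or_assoc]
      constructor
      · rintro (h | h)
        · obtain ⟨i, rfl, hi⟩ := Walk.mem_support_iff_exists_getVert.1 h
          by_cases him : i = m
          · subst him
            rw [hgm]; exact Or.inr (Or.inl ha)
          · exact Or.inl ⟨i, by omega, rfl⟩
        · exact Or.inr h
      · rintro (⟨i, hi, rfl⟩ | h)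
        · exact Or.inl (Walk.getVert_mem_support _ _)
        · exact Or.inr h
    · exfalso
      have h1 := hKmin _ (Or.inl hS)
      have h2 := Finset.card_lt_card hSW
      omega
  · left
    push Not at hbad
    have hnq : ∀ i j, i < m → j ≤ α + β → j ≠ α → R₁.getVert i ≠ q j := by
      intro i j hi hj hjα h
      rcases Nat.eq_zero_or_pos i with rfl | hi0
      · exact hb1q j hj (by simpa using h)
      have h0n : G.Adj (q 0) (q (α + β)) := (hq 0 _ (by omega) le_rfl).2 (by omega)
      have h1 := hRint i hi0 hi
      rw [h] at h1
      have hj0 : j ≠ 0 := by rintro rfl; exact h1.2 h0n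
      have hjn : j ≠ α + β := by rintro rfl; exact h1.1 h0n.symm
      rcases Nat.lt_or_ge j α with h' | h'
      · refine hbad i hi0 hi (j - 1) (by omega) (by omega) ?_
        rw [h, G.adj_comm, hq _ _ (by omega) (by omega)]
        omega
      · refine hbad i hi0 hi (j + 1) (by omega) (by omega) ?_
        rw [h, hq _ _ (by omega) (by omega)]
        omega
    have hRi : ∀ x ∈ R₁.reverse.support, ∃ i ≤ m, R₁.getVert i = x := by
      intro x hx
      rw [Walk.support_reverse, List.mem_reverse] at hx
      obtain ⟨i, hx, hi⟩ := Walk.mem_support_iff_exists_getVert.1 hx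
      exact ⟨i, by omega, hx⟩
    have hdis : ∀ x, x ∈ R₁.reverse.support → (x ∈ P₂.support ∨ x ∈ P₃.support) → x = a := by
      intro x hx hy
      obtain ⟨i, hi, rfl⟩ := hRi x hx
      obtain ⟨j, hj, h⟩ := (hmem _).1 hy
      by_cases him : i = m
      · rw [him, hgm]
      by_cases hjα : j = α
      · rw [h, hjα, qa]
      exact absurd h (hnq i j (by omega) hj hjα)
    have hedge : ∀ x ∈ R₁.reverse.support, ∀ y, (y ∈ P₂.support ∨ y ∈ P₃.support) →
        x ≠ a → y ≠ a → G.Adj x y → x = b₁ := by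
      intro x hx y hy hxa hya h
      obtain ⟨i, hi, rfl⟩ := hRi x hx
      obtain ⟨j, hj, rfl⟩ := (hmem _).1 hy
      have him : i ≠ m := by rintro rfl; exact hxa hgm
      have hjα : j ≠ α := by rintro rfl; exact hya qa
      rcases Nat.eq_zero_or_pos i with rfl | hi0
      · simp
      · exact absurd h (hbad i hi0 (by omega) j hj hjα)
    refine ⟨a, b₁, b₂, b₃, R₁.reverse, P₂, P₃, ⟨⟨hR₁.reverse, ?_⟩, hP2, hP3, h12, h23, h13,
      ha12, ha13, ha23, ⟨fun x hx hy => hdis x hx (Or.inl hy), ?_⟩,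
      ⟨fun x hx hy => hdis x hx (Or.inr hy), ?_⟩, pp23⟩, ?_⟩
    · intro x y hx hy h
      rw [Walk.support_reverse, List.mem_reverse] at hx hy
      rw [Walk.toSubgraph_reverse]
      exact hRind.2 x y hx hy h
    · intro x hx y hy hxa hya h
      have hxb := hedge x hx y (Or.inl hy) hxa hya h
      subst hxb
      exact pp12.2 _ P₁.end_mem_support y hy hxa hya h
    · intro x hx y hy hxa hya h
      have hxb := hedge x hx y (Or.inr hy) hxa hya h
      subst hxb
      exact pp13.2 _ P₁.end_mem_support y hy hxa hya h
    · rw [Walk.support_reverse, List.toFinset_reverse]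
end

section
/- Let G be a simple graph that contains no odd hole and contains an even prism as an induced subgraph, and let K be a smallest induced even prism of G (no induced even prism of G has fewer vertices). Let K be formed by chordless paths P1, P2, P3 and have frame (a1, a2, a3, b1, b2, b3, m1, m2, m3), with ai, mi, bi ∈ V(Pi) for i = 1,2,3. Let R be any path of G whose ends are a1 and m1, whose interior vertices are not adjacent to a2, a3, b2 or b3, and which is shortest with these properties. Then the concatenation a1-R-m1-P1-b1 is a chordless path R1, and R1, P2, P3 form a smallest induced even prism of G. -/
open SimpleGraph

/-- `G` has an induced even prism whose vertex set is exactly `S`. -/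
def HasEvenPrismOn {V : Type*} [DecidableEq V] (G : SimpleGraph V) (S : Finset V) : Prop :=
  ∃ (a₁ a₂ a₃ b₁ b₂ b₃ : V) (P₁ : G.Walk a₁ b₁) (P₂ : G.Walk a₂ b₂) (P₃ : G.Walk a₃ b₃),
    IsPrism G a₁ a₂ a₃ b₁ b₂ b₃ P₁ P₂ P₃ ∧
    Even P₁.length ∧ Even P₂.length ∧ Even P₃.length ∧
    P₁.support.toFinset ∪ P₂.support.toFinset ∪ P₃.support.toFinset = S

section Helpers

variable {V : Type*} {G : SimpleGraph V}

theorem indP_iff {u v : V} (p : G.Walk u v) : IsInducedPathW G p ↔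
    p.IsPath ∧ ∀ x y : V, x ∈ p.support → y ∈ p.support → G.Adj x y → s(x, y) ∈ p.edges := by
  simp only [IsInducedPathW, Walk.adj_toSubgraph_iff_mem_edges]

theorem append_meet {u v w x : V} {p : G.Walk u v} {q : G.Walk v w} (h : (p.append q).IsPath)
    (hp : x ∈ p.support) (hq : x ∈ q.support) : x = v := by
  by_contra hne
  exact h.ne_of_mem_support_of_append hne hp hq rfl

theorem indP_reverse {u v : V} {p : G.Walk u v} (h : IsInducedPathW G p) :
    IsInducedPathW G p.reverse := by
  rw [indP_iff] at h ⊢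
  refine ⟨h.1.reverse, fun x y hx hy hxy => ?_⟩
  simp only [Walk.support_reverse, List.mem_reverse, Walk.edges_reverse] at *
  exact h.2 x y hx hy hxy

theorem indP_left {u v w : V} {p : G.Walk u v} {q : G.Walk v w}
    (h : IsInducedPathW G (p.append q)) : IsInducedPathW G p := by
  rw [indP_iff] at h ⊢
  refine ⟨h.1.of_append_left, fun x y hx hy hxy => ?_⟩
  have := h.2 x y (by simp [hx]) (by simp [hy]) hxy
  rw [Walk.edges_append, List.mem_append] at this
  rcases this with h1 | h1
  · exact h1
  · have e1 := append_meet h.1 hx (q.fst_mem_support_of_mem_edges h1)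
    have e2 := append_meet h.1 hy (q.snd_mem_support_of_mem_edges h1)
    subst e1; subst e2; exact absurd hxy (G.loopless.irrefl _)

theorem indP_right {u v w : V} {p : G.Walk u v} {q : G.Walk v w}
    (h : IsInducedPathW G (p.append q)) : IsInducedPathW G q := by
  have h1 := indP_reverse h
  rw [Walk.reverse_append] at h1
  simpa using indP_reverse (indP_left h1)

/-- Two disjoint induced paths joined by a single edge form an induced path. -/
theorem indP_join {x y y' x' : V} {p : G.Walk x y} {q : G.Walk y' x'} (h : G.Adj y y')
    (hp : IsInducedPathW G p) (hq : IsInducedPathW G q)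
    (hd : ∀ z ∈ p.support, z ∉ q.support)
    (hc : ∀ z ∈ p.support, ∀ w ∈ q.support, G.Adj z w → z = y ∧ w = y') :
    IsInducedPathW G (p.append (Walk.cons h q)) := by
  rw [indP_iff] at *
  constructor
  · rw [Walk.isPath_def, Walk.support_append, Walk.support_cons, List.tail_cons,
      List.nodup_append']
    exact ⟨hp.1.support_nodup, hq.1.support_nodup, fun z h1 h2 => hd z h1 h2⟩
  · intro z w hz hw hzw
    simp only [Walk.support_append, Walk.support_cons, List.tail_cons, List.mem_append,
      Walk.edges_append, Walk.edges_cons, List.mem_cons] at *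
    rcases hz with hz | hz <;> rcases hw with hw | hw
    · exact Or.inl (hp.2 z w hz hw hzw)
    · obtain ⟨rfl, rfl⟩ := hc z hz w hw hzw
      simp
    · obtain ⟨rfl, rfl⟩ := hc w hw z hz hzw.symm
      simp [Sym2.eq_swap]
    · exact Or.inr (Or.inr (hq.2 z w hz hw hzw))

/-- Two disjoint induced paths joined by edges at both ends form an even hole if there is
no odd hole. -/
theorem hole_even (hOH : ¬ HasOddHole G) {x y y' x' : V} {p : G.Walk x y} {q : G.Walk y' x'}
    (h : G.Adj y y') (h' : G.Adj x x')
    (hp : IsInducedPathW G p) (hq : IsInducedPathW G q)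
    (hd : ∀ z ∈ p.support, z ∉ q.support)
    (hc : ∀ z ∈ p.support, ∀ w ∈ q.support, G.Adj z w → (z = y ∧ w = y') ∨ (z = x ∧ w = x'))
    (hl : 2 ≤ p.length + q.length) : Even (p.length + q.length) := by
  by_contra hodd
  apply hOH
  refine ⟨x', Walk.cons h'.symm (p.append (Walk.cons h q)), ⟨?_, ?_, ?_⟩, ?_⟩
  · rw [Walk.cons_isCycle_iff]
    constructor
    · rw [Walk.isPath_def, Walk.support_append, Walk.support_cons, List.tail_cons,
        List.nodup_append']
      exact ⟨hp.1.support_nodup, hq.1.support_nodup, fun z h1 h2 => hd z h1 h2⟩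
    · simp only [Walk.edges_append, Walk.edges_cons, List.mem_append, List.mem_cons]
      rintro (h1 | h1 | h1)
      · exact hd _ (p.fst_mem_support_of_mem_edges h1) q.end_mem_support
      · rw [Sym2.eq_iff] at h1
        rcases h1 with ⟨rfl, rfl⟩ | ⟨rfl, rfl⟩
        · exact hd _ p.end_mem_support q.end_mem_support
        · have e1 := Walk.isPath_iff_nil.1 hp.1
          have e2 := Walk.isPath_iff_nil.1 hq.1
          rw [← Walk.length_eq_zero_iff] at e1 e2
          omega
      · exact hd _ p.start_mem_support (q.snd_mem_support_of_mem_edges h1)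
  · simp; omega
  · rw [indP_iff] at *
    simp only [Walk.adj_toSubgraph_iff_mem_edges]
    intro z w hz hw hzw
    simp only [Walk.support_append, Walk.support_cons, List.tail_cons, List.mem_append,
      Walk.edges_append, Walk.edges_cons, List.mem_cons] at *
    have hz' : z ∈ p.support ∨ z ∈ q.support := by
      rcases hz with rfl | hz
      · exact Or.inr q.end_mem_support
      · exact hz
    have hw' : w ∈ p.support ∨ w ∈ q.support := by
      rcases hw with rfl | hw
      · exact Or.inr q.end_mem_support
      · exact hw
    rcases hz' with hz | hz <;> rcases hw' with hw | hw
    · exact Or.inr (Or.inl (hp.2 z w hz hw hzw))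
    · rcases hc z hz w hw hzw with ⟨rfl, rfl⟩ | ⟨rfl, rfl⟩ <;> simp [Sym2.eq_swap]
    · rcases hc w hw z hz hzw.symm with ⟨rfl, rfl⟩ | ⟨rfl, rfl⟩ <;> simp [Sym2.eq_swap]
    · exact Or.inr (Or.inr (Or.inr (hq.2 z w hz hw hzw)))
  · simp only [Walk.length_cons, Walk.length_append]
    rw [Nat.not_even_iff_odd] at hodd
    rcases hodd with ⟨k, hk⟩
    exact ⟨k + 1, by omega⟩

/-- Split a walk at the first vertex with a property. -/
theorem split_first (Pr : V → Prop) {u v : V} (p : G.Walk u v) (h : ∃ x ∈ p.support, Pr x) :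
    ∃ (c : V) (A : G.Walk u c) (B : G.Walk c v), p = A.append B ∧ Pr c ∧
      ∀ x ∈ A.support, Pr x → x = c := by
  induction p with
  | nil =>
    obtain ⟨x, hx, hP⟩ := h
    simp at hx
    subst hx
    exact ⟨x, Walk.nil, Walk.nil, rfl, hP, by simp⟩
  | @cons u w v e p ih =>
    by_cases hu : Pr u
    · exact ⟨u, Walk.nil, Walk.cons e p, rfl, hu, by simp⟩
    · obtain ⟨c, A, B, rfl, hc, hA⟩ := ih (by
        obtain ⟨x, hx, hP⟩ := h
        rw [Walk.support_cons, List.mem_cons] at hx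
        rcases hx with rfl | hx
        · exact absurd hP hu
        · exact ⟨x, hx, hP⟩)
      refine ⟨c, Walk.cons e A, B, rfl, hc, ?_⟩
      intro x hx hP
      rw [Walk.support_cons, List.mem_cons] at hx
      rcases hx with rfl | hx
      · exact absurd hP hu
      · exact hA x hx hP

/-- Split a walk at the last vertex with a property. -/
theorem split_last (Pr : V → Prop) {u v : V} (p : G.Walk u v) (h : ∃ x ∈ p.support, Pr x) :
    ∃ (c : V) (A : G.Walk u c) (B : G.Walk c v), p = A.append B ∧ Pr c ∧
      ∀ x ∈ B.support, Pr x → x = c := by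
  obtain ⟨c, A, B, hs, hc, hA⟩ := split_first Pr p.reverse (by simpa using h)
  refine ⟨c, B.reverse, A.reverse, ?_, hc, by simpa using hA⟩
  rw [← Walk.reverse_append, ← hs, Walk.reverse_reverse]

/-- A shortest walk inside its own vertex set is an induced path. -/
theorem indP_of_min {u v : V} (w : G.Walk u v)
    (hmin : ∀ q : G.Walk u v, (∀ x ∈ q.support, x ∈ w.support) → w.length ≤ q.length) :
    IsInducedPathW G w := by
  classical
  have key : ∀ (x y : V) (A : G.Walk u x) (B : G.Walk x y) (C : G.Walk y v),
      w = A.append (B.append C) → G.Adj x y → s(x, y) ∈ B.edges := by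
    intro x y A B C hw hxy
    have := hmin (A.append (Walk.cons hxy C)) (by
      intro z hz
      rw [hw]
      simp only [Walk.mem_support_append_iff, Walk.support_cons, List.mem_cons] at hz ⊢
      rcases hz with hz | rfl | hz
      · exact Or.inl hz
      · exact Or.inl A.end_mem_support
      · exact Or.inr (Or.inr hz))
    rw [hw] at this
    simp only [Walk.length_append, Walk.length_cons] at this
    cases B with
    | nil => exact absurd hxy (G.loopless.irrefl _)
    | cons e B =>
      cases B with
      | nil => simp
      | cons e' B => simp only [Walk.length_cons] at this; omega
  rw [indP_iff]
  constructor
  · have := hmin w.bypass (fun x hx => w.support_bypass_subset_support hx)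
    rw [← w.bypass_eq_self_of_length_le_length_bypass this]
    exact w.bypass_isPath
  · intro x y hx hy hxy
    obtain ⟨A, B, hw⟩ := Walk.mem_support_iff_exists_append.1 hx
    have hy' := hy
    rw [hw, Walk.mem_support_append_iff] at hy'
    rcases hy' with h1 | h1
    · obtain ⟨C, D, rfl⟩ := Walk.mem_support_iff_exists_append.1 h1
      have := key y x C D B (by rw [hw, Walk.append_assoc]) hxy.symm
      rw [Sym2.eq_swap] at this
      rw [hw]
      simp [this]
    · obtain ⟨C, D, rfl⟩ := Walk.mem_support_iff_exists_append.1 h1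
      have := key x y A C D hw hxy
      rw [hw]
      simp [this]

theorem exists_indP {u v : V} (w : G.Walk u v) :
    ∃ q : G.Walk u v, IsInducedPathW G q ∧ (∀ x ∈ q.support, x ∈ w.support) ∧
      q.length ≤ w.length := by
  induction hn : w.length using Nat.strong_induction_on generalizing w with
  | _ n ih =>
    by_cases h : ∀ q : G.Walk u v, (∀ x ∈ q.support, x ∈ w.support) → w.length ≤ q.length
    · exact ⟨w, indP_of_min w h, fun _ h => h, hn.le⟩
    · push Not at h
      obtain ⟨q, hq, hl⟩ := h
      obtain ⟨r, h1, h2, h3⟩ := ih q.length (by omega) q rfl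
      exact ⟨r, h1, fun x hx => hq x (h2 x hx), by omega⟩

theorem exists_nbr {u v x : V} (p : G.Walk u v) (h : u ≠ v) (hx : x ∈ p.support) :
    ∃ y ∈ p.support, G.Adj x y := by
  obtain ⟨A, B, rfl⟩ := Walk.mem_support_iff_exists_append.1 hx
  cases B with
  | cons e B => exact ⟨_, by simp, e⟩
  | nil =>
    rw [Walk.append_nil]
    cases hA : A.reverse with
    | nil => exact absurd rfl h
    | cons e B =>
      rename_i w
      refine ⟨w, ?_, e⟩
      have : w ∈ A.reverse.support := by rw [hA]; simp
      simpa using this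

theorem length_pos' {u v : V} (p : G.Walk u v) (h : u ≠ v) : 1 ≤ p.length := by
  cases p with
  | nil => exact absurd rfl h
  | cons e p => simp

/-- Replacing the first path of a prism. -/
theorem replace_prism {a₁ a₂ a₃ b₁ b₂ b₃ : V}
    {P₁ : G.Walk a₁ b₁} {P₂ : G.Walk a₂ b₂} {P₃ : G.Walk a₃ b₃}
    (hK : IsPrism G a₁ a₂ a₃ b₁ b₂ b₃ P₁ P₂ P₃) (T : G.Walk a₁ b₁) (hT : IsInducedPathW G T)
    (hN : ∀ x ∈ T.support, x ≠ a₁ → x ≠ b₁ →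
      (∀ y ∈ P₂.support, ¬ G.Adj x y) ∧ (∀ y ∈ P₃.support, ¬ G.Adj x y)) :
    IsPrism G a₁ a₂ a₃ b₁ b₂ b₃ T P₂ P₃ := by
  obtain ⟨-, i2, i3, h1, h2, h3, h4, h5, h6, n1, n2, n3, p12, p13, p23⟩ := hK
  refine ⟨hT, i2, i3, h1, h2, h3, h4, h5, h6, n1, n2, n3, ⟨?_, ?_⟩, ⟨?_, ?_⟩, p23⟩
  · intro x hx hx2
    by_cases ha : x = a₁
    · exact p12.1 x (ha ▸ P₁.start_mem_support) hx2
    by_cases hb : x = b₁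
    · exact p12.1 x (hb ▸ P₁.end_mem_support) hx2
    obtain ⟨y, hy, hxy⟩ := exists_nbr P₂ n2 hx2
    exact (hN x hx ha hb).1 y hy hxy
  · intro x hx y hy hxy
    by_cases ha : x = a₁
    · exact p12.2 x (ha ▸ P₁.start_mem_support) y hy hxy
    by_cases hb : x = b₁
    · exact p12.2 x (hb ▸ P₁.end_mem_support) y hy hxy
    exact absurd hxy ((hN x hx ha hb).1 y hy)
  · intro x hx hx2
    by_cases ha : x = a₁
    · exact p13.1 x (ha ▸ P₁.start_mem_support) hx2
    by_cases hb : x = b₁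
    · exact p13.1 x (hb ▸ P₁.end_mem_support) hx2
    obtain ⟨y, hy, hxy⟩ := exists_nbr P₃ n3 hx2
    exact (hN x hx ha hb).2 y hy hxy
  · intro x hx y hy hxy
    by_cases ha : x = a₁
    · exact p13.2 x (ha ▸ P₁.start_mem_support) y hy hxy
    by_cases hb : x = b₁
    · exact p13.2 x (hb ▸ P₁.end_mem_support) y hy hxy
    exact absurd hxy ((hN x hx ha hb).2 y hy)

theorem prism_even (hOH : ¬ HasOddHole G) {a₁ a₂ a₃ b₁ b₂ b₃ : V}
    {P₁ : G.Walk a₁ b₁} {P₂ : G.Walk a₂ b₂} {P₃ : G.Walk a₃ b₃}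
    (hK : IsPrism G a₁ a₂ a₃ b₁ b₂ b₃ P₁ P₂ P₃) : Even (P₁.length + P₂.length) := by
  obtain ⟨i1, i2, i3, h1, h2, h3, h4, h5, h6, n1, n2, n3, p12, p13, p23⟩ := hK
  have := hole_even hOH h4 h1 i1 (indP_reverse i2) (by simpa using p12.1)
    (by
      intro z hz w hw hzw
      rw [Walk.support_reverse, List.mem_reverse] at hw
      exact (p12.2 z hz w hw hzw).symm)
    (by
      have := length_pos' P₁ n1
      have := length_pos' P₂ n2
      rw [Walk.length_reverse]; omega)
  simpa using this

theorem card_prism [DecidableEq V] {a₁ a₂ a₃ b₁ b₂ b₃ : V}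
    {P₁ : G.Walk a₁ b₁} {P₂ : G.Walk a₂ b₂} {P₃ : G.Walk a₃ b₃}
    (hK : IsPrism G a₁ a₂ a₃ b₁ b₂ b₃ P₁ P₂ P₃) :
    (P₁.support.toFinset ∪ P₂.support.toFinset ∪ P₃.support.toFinset).card =
      P₁.length + P₂.length + P₃.length + 3 := by
  obtain ⟨i1, i2, i3, h1, h2, h3, h4, h5, h6, n1, n2, n3, p12, p13, p23⟩ := hK
  have c1 := List.toFinset_card_of_nodup i1.1.support_nodup
  have c2 := List.toFinset_card_of_nodup i2.1.support_nodup
  have c3 := List.toFinset_card_of_nodup i3.1.support_nodup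
  rw [Walk.length_support] at c1 c2 c3
  rw [Finset.card_union_of_disjoint, Finset.card_union_of_disjoint, c1, c2, c3]
  · omega
  · rw [Finset.disjoint_left]
    simpa using p12.1
  · rw [Finset.disjoint_left]
    intro x hx hx3
    simp only [Finset.mem_union, List.mem_toFinset] at hx hx3
    rcases hx with hx | hx
    · exact p13.1 x hx hx3
    · exact p23.1 x hx hx3

/-- The basic parity fact: a path `T` from `c` to `a₁`, an edge `a₁a₂`, and a path `A` from `a₂`
to the only neighbour of `c` on it. -/
theorem first_even (hOH : ¬ HasOddHole G) {c a₁ a₂ u : V} (T : G.Walk c a₁) (A : G.Walk a₂ u)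
    (hT : IsInducedPathW G T) (hA : IsInducedPathW G A) (haa : G.Adj a₁ a₂) (hcu : G.Adj c u)
    (hcA : c ∉ A.support) (hcN : ∀ x ∈ A.support, G.Adj c x → x = u)
    (hTA : ∀ x ∈ T.support, x ≠ c → x ∉ A.support ∧
      ∀ y ∈ A.support, G.Adj x y → x = a₁ ∧ y = a₂)
    (hca₁ : c ≠ a₁) (hca₂ : ¬ G.Adj c a₂) : Even (T.length + A.length) := by
  refine hole_even hOH haa hcu hT hA ?_ ?_ ?_
  · intro z hz
    by_cases h : z = c
    · rwa [h]
    · exact (hTA z hz h).1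
  · intro z hz w hw hzw
    by_cases h : z = c
    · subst h; exact Or.inr ⟨rfl, hcN w hw hzw⟩
    · exact Or.inl ((hTA z hz h).2 w hw hzw)
  · have := length_pos' T hca₁
    have := length_pos' A (by rintro rfl; exact hca₂ hcu)
    omega

/-- A vertex with exactly two neighbours on an induced path, its ends, closes an even hole. -/
theorem apex_even (hOH : ¬ HasOddHole G) {c u v : V} (J : G.Walk u v)
    (hJ : IsInducedPathW G J) (hcu : G.Adj c u) (hcv : G.Adj c v) (hcJ : c ∉ J.support)
    (hcN : ∀ x ∈ J.support, G.Adj c x → x = u ∨ x = v) (hl : 2 ≤ J.length) :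
    Even J.length := by
  have hn : IsInducedPathW G (Walk.nil : G.Walk c c) := by
    rw [indP_iff]
    refine ⟨Walk.IsPath.nil, ?_⟩
    intro x y hx hy hxy
    simp at hx hy
    subst hx; subst hy; exact absurd hxy (G.loopless.irrefl _)
  have := hole_even hOH hcu hcv hn hJ (by simpa using hcJ)
    (by
      intro z hz w hw hzw
      simp at hz
      subst hz
      simpa using hcN w hw hzw) (by simpa using hl)
  simpa using this

/-- `c` cannot attach to both paths. -/
theorem not_both (hOH : ¬ HasOddHole G) {c a₁ a₂ a₃ b₂ b₃ : V}
    {P₂ : G.Walk a₂ b₂} {P₃ : G.Walk a₃ b₃} (T : G.Walk c a₁)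
    (i2 : IsInducedPathW G P₂) (i3 : IsInducedPathW G P₃) (hT : IsInducedPathW G T)
    (p23 : PriPair G a₂ b₂ a₃ b₃ P₂ P₃)
    (h12 : G.Adj a₁ a₂) (h13 : G.Adj a₁ a₃) (h23 : G.Adj a₂ a₃)
    (hT2 : ∀ x ∈ T.support, x ≠ c → x ∉ P₂.support ∧
      ∀ y ∈ P₂.support, G.Adj x y → x = a₁ ∧ y = a₂)
    (hT3 : ∀ x ∈ T.support, x ≠ c → x ∉ P₃.support ∧
      ∀ y ∈ P₃.support, G.Adj x y → x = a₁ ∧ y = a₃)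
    (hc2 : c ∉ P₂.support) (hc3 : c ∉ P₃.support) (hca₁ : c ≠ a₁)
    (hca₂ : ¬ G.Adj c a₂) (hca₃ : ¬ G.Adj c a₃) (hcb₂ : ¬ G.Adj c b₂)
    (hN2 : ∃ y ∈ P₂.support, G.Adj c y) (hN3 : ∃ y ∈ P₃.support, G.Adj c y) : False := by
  obtain ⟨u, A, B, rfl, hu, hA⟩ := split_first (fun x => G.Adj c x) P₂ hN2
  obtain ⟨u', A', B', rfl, hu', hA'⟩ := split_first (fun x => G.Adj c x) P₃ hN3
  have sub : ∀ x ∈ A.support, x ∈ (A.append B).support := by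
    intro x hx; simp [hx]
  have sub' : ∀ x ∈ A'.support, x ∈ (A'.append B').support := by
    intro x hx; simp [hx]
  have e1 := first_even hOH T A hT (indP_left i2) h12 hu (fun h => hc2 (sub _ h)) hA
    (fun x hx hxc => ⟨fun h => (hT2 x hx hxc).1 (sub _ h),
      fun y hy => (hT2 x hx hxc).2 y (sub _ hy)⟩) hca₁ hca₂
  have e2 := first_even hOH T A' hT (indP_left i3) h13 hu' (fun h => hc3 (sub' _ h)) hA'
    (fun x hx hxc => ⟨fun h => (hT3 x hx hxc).1 (sub' _ h),
      fun y hy => (hT3 x hx hxc).2 y (sub' _ hy)⟩) hca₁ hca₃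
  have hb : b₂ ∉ A.support := by
    intro h
    have := append_meet i2.1 h B.end_mem_support
    subst this; exact hcb₂ hu
  have J := indP_join h23 (indP_reverse (indP_left i2)) (indP_left i3)
    (fun z hz hz' => p23.1 z (sub _ (by simpa using hz)) (sub' _ hz'))
    (fun z hz w hw hzw => by
      have hz' : z ∈ A.support := by simpa using hz
      rcases p23.2 z (sub _ hz') w (sub' _ hw) hzw with h | h
      · exact h
      · exact absurd (h.1 ▸ hz') hb)
  have l1 := length_pos' A (by rintro rfl; exact hca₂ hu)
  have e3 := apex_even hOH _ J hu hu'
    (by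
      simp only [Walk.mem_support_append_iff, Walk.support_cons, List.mem_cons,
        Walk.support_reverse, List.mem_reverse]
      rintro (h | h | h)
      · exact hc2 (sub _ h)
      · exact hc2 (h ▸ sub _ A.start_mem_support)
      · exact hc3 (sub' _ h))
    (by
      simp only [Walk.mem_support_append_iff, Walk.support_cons, List.mem_cons,
        Walk.support_reverse, List.mem_reverse]
      rintro x (h | h | h) hx
      · exact Or.inl (hA x h hx)
      · exact absurd (h ▸ hx) hca₂
      · exact Or.inr (hA' x h hx))
    (by simp; omega)
  simp only [Walk.length_append, Walk.length_reverse, Walk.length_cons] at e3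
  rw [Nat.even_iff] at *
  omega

/-- The attachment of `c` on `P₂ = A M D`. -/
theorem attach [DecidableEq V] (hOH : ¬ HasOddHole G) {c a₁ a₂ a₃ b₂ b₃ u v : V}
    (A : G.Walk a₂ u) (M : G.Walk u v) (D : G.Walk v b₂)
    (P₃ : G.Walk a₃ b₃) (T : G.Walk c a₁)
    (i2 : IsInducedPathW G (A.append (M.append D))) (i3 : IsInducedPathW G P₃)
    (hT : IsInducedPathW G T)
    (p23 : PriPair G a₂ b₂ a₃ b₃ (A.append (M.append D)) P₃)
    (h12 : G.Adj a₁ a₂) (h13 : G.Adj a₁ a₃) (h23 : G.Adj a₂ a₃) (hb23 : G.Adj b₂ b₃)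
    (n3 : a₃ ≠ b₃)
    (hT2 : ∀ x ∈ T.support, x ≠ c → x ∉ (A.append (M.append D)).support ∧
      ∀ y ∈ (A.append (M.append D)).support, G.Adj x y → x = a₁ ∧ y = a₂)
    (hT3 : ∀ x ∈ T.support, x ≠ c → x ∉ P₃.support ∧
      ∀ y ∈ P₃.support, G.Adj x y → x = a₁ ∧ y = a₃)
    (hc2 : c ∉ (A.append (M.append D)).support) (hc3 : c ∉ P₃.support) (hca₁ : c ≠ a₁)
    (hca₂ : ¬ G.Adj c a₂) (hcb₂ : ¬ G.Adj c b₂)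
    (hN3 : ∀ y ∈ P₃.support, ¬ G.Adj c y)
    (hcu : G.Adj c u) (hcv : G.Adj c v)
    (hA : ∀ x ∈ A.support, G.Adj c x → x = u) (hD : ∀ x ∈ D.support, G.Adj c x → x = v)
    (hE2 : Even (A.append (M.append D)).length) (hE3 : Even P₃.length) :
    M.length = 1 ∧ Even (T.length + A.length) ∧
      (Even T.length → ∃ S, HasEvenPrismOn G S ∧
        S.card = T.length + (A.append (M.append D)).length + P₃.length + 3) := by
  have subA : ∀ x ∈ A.support, x ∈ (A.append (M.append D)).support := by
    intro x hx; simp [hx]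
  have subM : ∀ x ∈ M.support, x ∈ (M.append D).support := by
    intro x hx; simp [hx]
  have subD' : ∀ x ∈ D.support, x ∈ (M.append D).support := by
    intro x hx; simp [hx]
  have subD : ∀ x ∈ D.support, x ∈ (A.append (M.append D)).support := by
    intro x hx; simp [hx]
  have iA := indP_left i2
  have iD := indP_right (indP_right i2)
  have pMD := i2.1.of_append_right
  have hbA : b₂ ∉ A.support := by
    intro h
    have := append_meet i2.1 h (M.append D).end_mem_support
    subst this; exact hcb₂ hcu
  have haD : a₂ ∉ D.support := by
    intro h
    have := append_meet i2.1 A.start_mem_support (subD' _ h)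
    subst this; exact hca₂ hcu
  have lA := length_pos' A (by rintro rfl; exact hca₂ hcu)
  have lD := length_pos' D (by rintro rfl; exact hcb₂ hcv)
  -- the path from `a₃` to `v`
  have J := indP_join hb23.symm i3 (indP_reverse iD)
    (fun z hz hz' => p23.1 z (subD _ (by simpa using hz')) hz)
    (fun z hz w hw hzw => by
      have hw' : w ∈ D.support := by simpa using hw
      rcases p23.2 w (subD _ hw') z hz hzw.symm with h | h
      · exact absurd (h.1 ▸ hw') haD
      · exact h.symm)
  have memJ : ∀ x, x ∈ (P₃.append (Walk.cons hb23.symm D.reverse)).support ↔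
      x ∈ P₃.support ∨ x ∈ D.support := by
    intro x
    simp only [Walk.mem_support_append_iff, Walk.support_cons, List.mem_cons,
        Walk.support_reverse, List.mem_reverse]
    constructor
    · rintro (h | h | h)
      · exact Or.inl h
      · exact Or.inl (h ▸ P₃.end_mem_support)
      · exact Or.inr h
    · rintro (h | h)
      · exact Or.inl h
      · exact Or.inr (Or.inr h)
  have lenJ : (P₃.append (Walk.cons hb23.symm D.reverse)).length =
      P₃.length + D.length + 1 := by
    simp; omega
  generalize P₃.append (Walk.cons hb23.symm D.reverse) = Jw at J memJ lenJ
  have cJ : c ∉ Jw.support := by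
    rw [memJ]
    rintro (h | h)
    · exact hc3 h
    · exact hc2 (subD _ h)
  have NJ : ∀ x ∈ Jw.support, G.Adj c x → x = v := by
    intro x hx hcx
    rw [memJ] at hx
    rcases hx with h | h
    · exact absurd hcx (hN3 x h)
    · exact hD x h hcx
  have TJ : ∀ x ∈ T.support, x ≠ c → x ∉ Jw.support ∧
      ∀ y ∈ Jw.support, G.Adj x y → x = a₁ ∧ y = a₃ := by
    intro x hx hxc
    refine ⟨?_, ?_⟩
    · rw [memJ]
      rintro (h | h)
      · exact (hT3 x hx hxc).1 h
      · exact (hT2 x hx hxc).1 (subD _ h)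
    · intro y hy hxy
      rw [memJ] at hy
      rcases hy with h | h
      · exact (hT3 x hx hxc).2 y h hxy
      · have := (hT2 x hx hxc).2 y (subD _ h) hxy
        exact absurd (this.2 ▸ h) haD
  have TA : ∀ x ∈ T.support, x ≠ c → x ∉ A.support ∧
      ∀ y ∈ A.support, G.Adj x y → x = a₁ ∧ y = a₂ :=
    fun x hx hxc => ⟨fun h => (hT2 x hx hxc).1 (subA _ h),
      fun y hy => (hT2 x hx hxc).2 y (subA _ hy)⟩
  have cA : c ∉ A.support := fun h => hc2 (subA _ h)
  have e1 := first_even hOH T A hT iA h12 hcu cA hA TA hca₁ hca₂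
  have e2 := first_even hOH T Jw hT J h13 hcv cJ NJ TJ hca₁ (hN3 _ P₃.start_mem_support)
  have hlen : (A.append (M.append D)).length = A.length + M.length + D.length := by
    simp [add_assoc]
  have hMpos : 1 ≤ M.length := by
    rw [hlen] at hE2
    rw [lenJ] at e2
    rw [Nat.even_iff] at *
    omega
  have huv : u ≠ v := by
    rintro rfl
    have := Walk.isPath_iff_nil.1 pMD.of_append_left
    rw [← Walk.length_eq_zero_iff] at this
    omega
  have AD : ∀ x ∈ A.support, x ∉ D.support := by
    intro x hx hx'
    have e := append_meet i2.1 hx (subD' _ hx')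
    subst e
    exact huv (append_meet pMD M.start_mem_support hx')
  have ADadj : ∀ x ∈ A.support, ∀ y ∈ D.support, G.Adj x y →
      M.length = 1 ∧ x = u ∧ y = v := by
    intro x hx y hy hxy
    have h := ((indP_iff _).1 i2).2 x y (subA _ hx) (subD _ hy) hxy
    simp only [Walk.edges_append, List.mem_append] at h
    rcases h with h | h | h
    · exact absurd hy (AD y (A.snd_mem_support_of_mem_edges h))
    · have hxu := append_meet i2.1 hx (subM _ (M.fst_mem_support_of_mem_edges h))
      have hyv := append_meet pMD (M.snd_mem_support_of_mem_edges h) hy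
      subst hxu; subst hyv
      exact ⟨pMD.of_append_left.length_eq_one_of_mem_edges h, rfl, rfl⟩
    · exact absurd (D.fst_mem_support_of_mem_edges h) (AD x hx)
  have AJ : ∀ x ∈ A.support, x ∉ Jw.support := by
    intro x hx hx'
    rw [memJ] at hx'
    rcases hx' with h | h
    · exact p23.1 x (subA _ hx) h
    · exact AD x hx h
  have AJadj : ∀ x ∈ A.support, ∀ y ∈ Jw.support, G.Adj x y →
      (x = a₂ ∧ y = a₃) ∨ (M.length = 1 ∧ x = u ∧ y = v) := by
    intro x hx y hy hxy
    rw [memJ] at hy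
    rcases hy with h | h
    · rcases p23.2 x (subA _ hx) y h hxy with h' | h'
      · exact Or.inl h'
      · exact absurd (h'.1 ▸ hx) hbA
    · exact Or.inr (ADadj x hx y h hxy)
  have hM : M.length = 1 := by
    by_contra hM
    have I := indP_join h23 (indP_reverse iA) J
      (fun z hz => AJ z (by simpa using hz))
      (fun z hz w hw hzw => by
        rcases AJadj z (by simpa using hz) w hw hzw with h | h
        · exact h
        · exact absurd h.1 hM)
    have e3 := apex_even hOH _ I hcu hcv
      (by
        simp only [Walk.mem_support_append_iff, Walk.support_cons, List.mem_cons,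
          Walk.support_reverse, List.mem_reverse]
        rintro (h | h | h)
        · exact cA h
        · exact cA (h ▸ A.start_mem_support)
        · exact cJ h)
      (by
        simp only [Walk.mem_support_append_iff, Walk.support_cons, List.mem_cons,
          Walk.support_reverse, List.mem_reverse]
        rintro x (h | h | h) hx
        · exact Or.inl (hA x h hx)
        · exact absurd (h ▸ hx) hca₂
        · exact Or.inr (NJ x h hx))
      (by simp; omega)
    simp only [Walk.length_append, Walk.length_reverse, Walk.length_cons] at e3
    rw [Nat.even_iff] at *
    omega
  refine ⟨hM, e1, fun hTe => ?_⟩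
  have huv' : G.Adj u v := Walk.adj_of_length_eq_one hM
  have hP : IsPrism G a₁ a₂ a₃ c u v T.reverse A Jw := by
    refine ⟨indP_reverse hT, iA, J, h12, h23, h13, hcu, huv', hcv, hca₁.symm, ?_, ?_,
      ⟨?_, ?_⟩, ⟨?_, ?_⟩, ⟨AJ, ?_⟩⟩
    · rintro rfl; exact hca₂ hcu
    · rintro rfl; exact hN3 _ P₃.start_mem_support hcv
    · intro x hx
      have hx : x ∈ T.support := by simpa using hx
      by_cases hxc : x = c
      · rwa [hxc]
      · exact (TA x hx hxc).1
    · intro x hx y hy hxy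
      have hx : x ∈ T.support := by simpa using hx
      by_cases hxc : x = c
      · subst hxc; exact Or.inr ⟨rfl, hA y hy hxy⟩
      · exact Or.inl ((TA x hx hxc).2 y hy hxy)
    · intro x hx
      have hx : x ∈ T.support := by simpa using hx
      by_cases hxc : x = c
      · rwa [hxc]
      · exact (TJ x hx hxc).1
    · intro x hx y hy hxy
      have hx : x ∈ T.support := by simpa using hx
      by_cases hxc : x = c
      · subst hxc; exact Or.inr ⟨rfl, NJ y hy hxy⟩
      · exact Or.inl ((TJ x hx hxc).2 y hy hxy)
    · intro x hx y hy hxy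
      rcases AJadj x hx y hy hxy with h | h
      · exact Or.inl h
      · exact Or.inr h.2
  refine ⟨_, ⟨a₁, a₂, a₃, c, u, v, T.reverse, A, Jw, hP, by simpa using hTe, ?_, ?_, rfl⟩, ?_⟩
  · rw [Nat.even_iff] at *; omega
  · rw [Nat.even_iff] at *; omega
  · rw [card_prism hP, Walk.length_reverse]; omega

theorem priPair_symm {ai bi aj bj : V} {Pi : G.Walk ai bi} {Pj : G.Walk aj bj}
    (h : PriPair G ai bi aj bj Pi Pj) : PriPair G aj bj ai bi Pj Pi := by
  refine ⟨fun x hx hx' => h.1 x hx' hx, fun x hx y hy hxy => ?_⟩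
  rcases h.2 y hy x hx hxy.symm with h | h
  · exact Or.inl h.symm
  · exact Or.inr h.symm

theorem priPair_reverse {ai bi aj bj : V} {Pi : G.Walk ai bi} {Pj : G.Walk aj bj}
    (h : PriPair G ai bi aj bj Pi Pj) : PriPair G bi ai bj aj Pi.reverse Pj.reverse := by
  refine ⟨by simpa using h.1, fun x hx y hy hxy => ?_⟩
  exact (h.2 x (by simpa using hx) y (by simpa using hy) hxy).symm

theorem no_attach [DecidableEq V] (hOH : ¬ HasOddHole G) {c a₁ a₂ a₃ b₁ b₂ b₃ : V}
    (P₂ : G.Walk a₂ b₂) (P₃ : G.Walk a₃ b₃) (T : G.Walk c a₁) (T' : G.Walk c b₁)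
    (i2 : IsInducedPathW G P₂) (i3 : IsInducedPathW G P₃)
    (hT : IsInducedPathW G T) (hT' : IsInducedPathW G T')
    (p23 : PriPair G a₂ b₂ a₃ b₃ P₂ P₃)
    (h12 : G.Adj a₁ a₂) (h13 : G.Adj a₁ a₃) (h23 : G.Adj a₂ a₃)
    (hb12 : G.Adj b₁ b₂) (hb13 : G.Adj b₁ b₃) (hb23 : G.Adj b₂ b₃)
    (n3 : a₃ ≠ b₃)
    (hT2 : ∀ x ∈ T.support, x ≠ c → x ∉ P₂.support ∧
      ∀ y ∈ P₂.support, G.Adj x y → x = a₁ ∧ y = a₂)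
    (hT3 : ∀ x ∈ T.support, x ≠ c → x ∉ P₃.support ∧
      ∀ y ∈ P₃.support, G.Adj x y → x = a₁ ∧ y = a₃)
    (hT2' : ∀ x ∈ T'.support, x ≠ c → x ∉ P₂.support ∧
      ∀ y ∈ P₂.support, G.Adj x y → x = b₁ ∧ y = b₂)
    (hT3' : ∀ x ∈ T'.support, x ≠ c → x ∉ P₃.support ∧
      ∀ y ∈ P₃.support, G.Adj x y → x = b₁ ∧ y = b₃)
    (hc2 : c ∉ P₂.support) (hc3 : c ∉ P₃.support) (hca₁ : c ≠ a₁) (hcb₁ : c ≠ b₁)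
    (hca₂ : ¬ G.Adj c a₂) (hca₃ : ¬ G.Adj c a₃) (hcb₂ : ¬ G.Adj c b₂)
    (hN2 : ∃ y ∈ P₂.support, G.Adj c y)
    (hE2 : Even P₂.length) (hE3 : Even P₃.length) (n : ℕ)
    (hmin : ∀ S : Finset V, HasEvenPrismOn G S → n + P₂.length + P₃.length + 3 ≤ S.card)
    (hTl : T.length < n) (hTl' : T'.length < n) : False := by
  have hN3 : ∀ y ∈ P₃.support, ¬ G.Adj c y := by
    intro y hy hcy
    exact not_both hOH T i2 i3 hT p23 h12 h13 h23 hT2 hT3 hc2 hc3 hca₁ hca₂ hca₃ hcb₂ hN2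
      ⟨y, hy, hcy⟩
  obtain ⟨u, A, B, rfl, hu, hA⟩ := split_first (fun x => G.Adj c x) P₂ hN2
  obtain ⟨v, M, D, rfl, hv, hD⟩ := split_last (fun x => G.Adj c x) B
    ⟨u, B.start_mem_support, hu⟩
  obtain ⟨m1, e1, s1⟩ := attach hOH A M D P₃ T i2 i3 hT p23 h12 h13 h23 hb23 n3 hT2 hT3 hc2 hc3
    hca₁ hca₂ hcb₂ hN3 hu hv hA hD hE2 hE3
  have hrev : D.reverse.append (M.reverse.append A.reverse) =
      (A.append (M.append D)).reverse := by
    rw [Walk.reverse_append, Walk.reverse_append, Walk.append_assoc]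
  have mrev : ∀ x, x ∈ (D.reverse.append (M.reverse.append A.reverse)).support ↔
      x ∈ (A.append (M.append D)).support := by
    intro x; rw [hrev]; simp only [Walk.support_reverse, List.mem_reverse]
  have mrev3 : ∀ x, x ∈ P₃.reverse.support ↔ x ∈ P₃.support := by
    intro x; simp only [Walk.support_reverse, List.mem_reverse]
  have lrev : (D.reverse.append (M.reverse.append A.reverse)).length =
      (A.append (M.append D)).length := by
    rw [hrev, Walk.length_reverse]
  obtain ⟨m2, e2, s2⟩ := attach hOH D.reverse M.reverse A.reverse P₃.reverse T'
    (by rw [hrev]; exact indP_reverse i2) (indP_reverse i3) hT'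
    (by rw [hrev]; exact priPair_reverse p23) hb12 hb13 hb23 h23 n3.symm
    (by simpa only [mrev] using hT2') (by simpa only [mrev3] using hT3')
    (by simpa only [mrev] using hc2) (by simpa only [mrev3] using hc3)
    hcb₁ hcb₂ hca₂ (by simpa only [mrev3] using hN3) hv hu
    (by simpa using hD) (by simpa using hA)
    (by rw [lrev]; exact hE2) (by simpa using hE3)
  have hne : ¬ Even T.length := by
    intro h
    obtain ⟨S, hS, hcard⟩ := s1 h
    have := hmin S hS
    omega
  have hne' : ¬ Even T'.length := by
    intro h
    obtain ⟨S, hS, hcard⟩ := s2 h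
    have := hmin S hS
    rw [lrev, Walk.length_reverse] at hcard
    omega
  clear s1 s2 hmin
  simp only [Walk.length_append, Walk.length_reverse] at e1 e2 hE2
  rw [Nat.even_iff] at e1 e2 hE2 hne hne'
  omega

end Helpers

/-- Let `G` contain no odd hole, let `K` be a smallest induced even
prism of `G`, formed by `P₁, P₂, P₃` with frame `(a₁,a₂,a₃,b₁,b₂,b₃,m₁,m₂,m₃)`
(`mᵢ` being the middle vertex of `Pᵢ`, witnessed by the splittings `Pᵢ = Qᵢ ++ Sᵢ`).
Let `R` be a shortest path from `a₁` to `m₁` whose interior vertices are not adjacent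
to `a₂, a₃, b₂, b₃`. Then `a₁-R-m₁-P₁-b₁` is a chordless path `R₁` and `R₁, P₂, P₃`
form a smallest induced even prism of `G`. -/
theorem smallest_even_prism_replace_half_path
    {V : Type*} [Fintype V] [DecidableEq V] (G : SimpleGraph V)
    (hOH : ¬ HasOddHole G)
    (a₁ a₂ a₃ b₁ b₂ b₃ m₁ m₂ m₃ : V)
    (P₁ : G.Walk a₁ b₁) (P₂ : G.Walk a₂ b₂) (P₃ : G.Walk a₃ b₃)
    (hK : IsPrism G a₁ a₂ a₃ b₁ b₂ b₃ P₁ P₂ P₃)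
    (hE₁ : Even P₁.length) (hE₂ : Even P₂.length) (hE₃ : Even P₃.length)
    (hKmin : ∀ S : Finset V, HasEvenPrismOn G S →
      (P₁.support.toFinset ∪ P₂.support.toFinset ∪ P₃.support.toFinset).card ≤ S.card)
    (Q₁ : G.Walk a₁ m₁) (S₁ : G.Walk m₁ b₁)
    (Q₂ : G.Walk a₂ m₂) (S₂ : G.Walk m₂ b₂)
    (Q₃ : G.Walk a₃ m₃) (S₃ : G.Walk m₃ b₃)
    (hsplit₁ : P₁ = Q₁.append S₁) (hmid₁ : Q₁.length = S₁.length)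
    (hsplit₂ : P₂ = Q₂.append S₂) (hmid₂ : Q₂.length = S₂.length)
    (hsplit₃ : P₃ = Q₃.append S₃) (hmid₃ : Q₃.length = S₃.length)
    (R : G.Walk a₁ m₁) (hR : R.IsPath)
    (hRint : ∀ x ∈ R.support, x ≠ a₁ → x ≠ m₁ →
      ¬ G.Adj x a₂ ∧ ¬ G.Adj x a₃ ∧ ¬ G.Adj x b₂ ∧ ¬ G.Adj x b₃)
    (hRshort : ∀ Q : G.Walk a₁ m₁, Q.IsPath →
      (∀ x ∈ Q.support, x ≠ a₁ → x ≠ m₁ →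
        ¬ G.Adj x a₂ ∧ ¬ G.Adj x a₃ ∧ ¬ G.Adj x b₂ ∧ ¬ G.Adj x b₃) →
      R.length ≤ Q.length) :
    IsInducedPathW G (R.append S₁) ∧
    IsPrism G a₁ a₂ a₃ b₁ b₂ b₃ (R.append S₁) P₂ P₃ ∧
    Even (R.append S₁).length ∧
    ∀ S : Finset V, HasEvenPrismOn G S →
      ((R.append S₁).support.toFinset ∪ P₂.support.toFinset ∪
        P₃.support.toFinset).card ≤ S.card := by
  have hK' := hK
  obtain ⟨i1, i2, i3, h12, h23, h13, hb12, hb23, hb13, n1, n2, n3, p12, p13, p23⟩ := hK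
  rw [card_prism hK'] at hKmin
  have iQ : IsInducedPathW G Q₁ := indP_left (hsplit₁ ▸ i1)
  have pP : (Q₁.append S₁).IsPath := hsplit₁ ▸ i1.1
  have l1 : P₁.length = Q₁.length + S₁.length := by rw [hsplit₁, Walk.length_append]
  have l1pos := length_pos' P₁ n1
  have subQ : ∀ x ∈ Q₁.support, x ∈ P₁.support := by
    intro x hx; rw [hsplit₁]; simp [hx]
  have subS : ∀ x ∈ S₁.support, x ∈ P₁.support := by
    intro x hx; rw [hsplit₁]; simp [hx]
  have hm : m₁ ∈ P₁.support := subQ _ Q₁.end_mem_support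
  have hma : m₁ ≠ a₁ := by
    rintro rfl
    have := Walk.isPath_iff_nil.1 iQ.1
    rw [← Walk.length_eq_zero_iff] at this
    omega
  have hmb : m₁ ≠ b₁ := by
    rintro rfl
    have := Walk.isPath_iff_nil.1 pP.of_append_right
    rw [← Walk.length_eq_zero_iff] at this
    omega
  have haS : a₁ ∉ S₁.support := fun h => hma (append_meet pP Q₁.start_mem_support h).symm
  have hbQ : b₁ ∉ Q₁.support := fun h => hmb (append_meet pP h S₁.end_mem_support).symm
  -- interior vertices of `P₁` have no neighbours on the other paths
  have inner : ∀ x ∈ P₁.support, x ≠ a₁ → x ≠ b₁ →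
      (∀ y ∈ P₂.support, ¬ G.Adj x y) ∧ (∀ y ∈ P₃.support, ¬ G.Adj x y) := by
    intro x hx ha hb
    refine ⟨fun y hy hxy => ?_, fun y hy hxy => ?_⟩
    · rcases p12.2 x hx y hy hxy with h | h
      · exact ha h.1
      · exact hb h.1
    · rcases p13.2 x hx y hy hxy with h | h
      · exact ha h.1
      · exact hb h.1
  have hRle : R.length ≤ Q₁.length := by
    apply hRshort Q₁ iQ.1
    intro x hx ha _
    have := inner x (subQ x hx) ha (by rintro rfl; exact hbQ hx)
    exact ⟨this.1 _ P₂.start_mem_support, this.2 _ P₃.start_mem_support,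
      this.1 _ P₂.end_mem_support, this.2 _ P₃.end_mem_support⟩
  by_cases hgood : ∀ x ∈ R.support, x ≠ a₁ →
      (∀ y ∈ P₂.support, ¬ G.Adj x y) ∧ (∀ y ∈ P₃.support, ¬ G.Adj x y)
  · -- the good case
    have hN : ∀ x ∈ (R.append S₁).support, x ≠ a₁ → x ≠ b₁ →
        (∀ y ∈ P₂.support, ¬ G.Adj x y) ∧ (∀ y ∈ P₃.support, ¬ G.Adj x y) := by
      intro x hx ha hb
      rw [Walk.mem_support_append_iff] at hx
      rcases hx with hx | hx
      · exact hgood x hx ha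
      · exact inner x (subS x hx) ha hb
    have key : ∀ T : G.Walk a₁ b₁, IsInducedPathW G T →
        (∀ x ∈ T.support, x ∈ (R.append S₁).support) →
        IsPrism G a₁ a₂ a₃ b₁ b₂ b₃ T P₂ P₃ ∧ Even T.length ∧ P₁.length ≤ T.length := by
      intro T hT hsub
      have hP := replace_prism hK' T hT (fun x hx => hN x (hsub x hx))
      have hev := prism_even hOH hP
      have hev' : Even T.length := by
        rw [Nat.even_iff] at *; omega
      have := hKmin _ ⟨a₁, a₂, a₃, b₁, b₂, b₃, T, P₂, P₃, hP, hev', hE₂, hE₃, rfl⟩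
      rw [card_prism hP] at this
      exact ⟨hP, hev', by omega⟩
    have hlen : (R.append S₁).length = R.length + S₁.length := Walk.length_append _ _
    have hind : IsInducedPathW G (R.append S₁) := by
      apply indP_of_min
      intro q hq
      obtain ⟨T, hT, hTs, hTl⟩ := exists_indP q
      have := (key T hT (fun x hx => hq x (hTs x hx))).2.2
      omega
    obtain ⟨hP, hev, hle⟩ := key _ hind (fun x hx => hx)
    refine ⟨hind, hP, hev, ?_⟩
    rw [card_prism hP]
    intro S hS
    have := hKmin S hS
    omega
  · -- some interior vertex of `R` attaches to the other paths: impossible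
    exfalso
    obtain ⟨c, B, E, hBE, hc, hE⟩ := split_last (fun x => x ≠ a₁ ∧
      ¬ ((∀ y ∈ P₂.support, ¬ G.Adj x y) ∧ (∀ y ∈ P₃.support, ¬ G.Adj x y))) R
      (by push Not at hgood ⊢; exact hgood)
    obtain ⟨hca, hcN⟩ := hc
    have pBE : (B.append E).IsPath := hBE ▸ hR
    have hcR : c ∈ R.support := by rw [hBE]; simp
    have hcm : c ≠ m₁ := by
      rintro rfl
      exact hcN (inner _ hm hma hmb)
    obtain ⟨hca₂, hca₃, hcb₂, hcb₃⟩ := hRint c hcR hca hcm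
    have hcb : c ≠ b₁ := by
      rintro rfl
      exact hcb₂ hb12
    have lB := length_pos' B hca.symm
    have lR : R.length = B.length + E.length := by rw [hBE, Walk.length_append]
    have hE' : ∀ x ∈ E.support, x ≠ c →
        (∀ y ∈ P₂.support, ¬ G.Adj x y) ∧ (∀ y ∈ P₃.support, ¬ G.Adj x y) := by
      intro x hx hxc
      by_contra h
      refine hxc (hE x hx ⟨?_, h⟩)
      rintro rfl
      exact hxc (append_meet pBE B.start_mem_support hx)
    have hc23 : c ∉ P₂.support ∧ c ∉ P₃.support := by
      obtain ⟨y, hy, hcy⟩ := exists_nbr E hcm E.start_mem_support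
      have := hE' y hy (by rintro rfl; exact G.loopless.irrefl _ hcy)
      exact ⟨fun h => this.1 c h hcy.symm, fun h => this.2 c h hcy.symm⟩
    have hEm : ∀ x ∈ E.support, x ≠ c → x ∉ P₂.support ∧ x ∉ P₃.support := by
      intro x hx hxc
      constructor
      · intro h
        obtain ⟨y, hy, hxy⟩ := exists_nbr P₂ n2 h
        exact (hE' x hx hxc).1 y hy hxy
      · intro h
        obtain ⟨y, hy, hxy⟩ := exists_nbr P₃ n3 h
        exact (hE' x hx hxc).2 y hy hxy
    obtain ⟨T, hT, hTs, hTl⟩ := exists_indP (E.append Q₁.reverse)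
    obtain ⟨T', hT', hTs', hTl'⟩ := exists_indP (E.append S₁)
    rw [Walk.length_append] at hTl hTl'
    rw [Walk.length_reverse] at hTl
    have hT2 : ∀ x ∈ T.support, x ≠ c → x ∉ P₂.support ∧
        ∀ y ∈ P₂.support, G.Adj x y → x = a₁ ∧ y = a₂ := by
      intro x hx hxc
      have := hTs x hx
      rw [Walk.mem_support_append_iff, Walk.support_reverse, List.mem_reverse] at this
      rcases this with h | h
      · exact ⟨(hEm x h hxc).1, fun y hy hxy => absurd hxy ((hE' x h hxc).1 y hy)⟩
      · refine ⟨p12.1 x (subQ x h), fun y hy hxy => ?_⟩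
        rcases p12.2 x (subQ x h) y hy hxy with h' | h'
        · exact h'
        · exact absurd (h'.1 ▸ h) hbQ
    have hT3 : ∀ x ∈ T.support, x ≠ c → x ∉ P₃.support ∧
        ∀ y ∈ P₃.support, G.Adj x y → x = a₁ ∧ y = a₃ := by
      intro x hx hxc
      have := hTs x hx
      rw [Walk.mem_support_append_iff, Walk.support_reverse, List.mem_reverse] at this
      rcases this with h | h
      · exact ⟨(hEm x h hxc).2, fun y hy hxy => absurd hxy ((hE' x h hxc).2 y hy)⟩
      · refine ⟨p13.1 x (subQ x h), fun y hy hxy => ?_⟩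
        rcases p13.2 x (subQ x h) y hy hxy with h' | h'
        · exact h'
        · exact absurd (h'.1 ▸ h) hbQ
    have hT2' : ∀ x ∈ T'.support, x ≠ c → x ∉ P₂.support ∧
        ∀ y ∈ P₂.support, G.Adj x y → x = b₁ ∧ y = b₂ := by
      intro x hx hxc
      have := hTs' x hx
      rw [Walk.mem_support_append_iff] at this
      rcases this with h | h
      · exact ⟨(hEm x h hxc).1, fun y hy hxy => absurd hxy ((hE' x h hxc).1 y hy)⟩
      · refine ⟨p12.1 x (subS x h), fun y hy hxy => ?_⟩
        rcases p12.2 x (subS x h) y hy hxy with h' | h'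
        · exact absurd (h'.1 ▸ h) haS
        · exact h'
    have hT3' : ∀ x ∈ T'.support, x ≠ c → x ∉ P₃.support ∧
        ∀ y ∈ P₃.support, G.Adj x y → x = b₁ ∧ y = b₃ := by
      intro x hx hxc
      have := hTs' x hx
      rw [Walk.mem_support_append_iff] at this
      rcases this with h | h
      · exact ⟨(hEm x h hxc).2, fun y hy hxy => absurd hxy ((hE' x h hxc).2 y hy)⟩
      · refine ⟨p13.1 x (subS x h), fun y hy hxy => ?_⟩
        rcases p13.2 x (subS x h) y hy hxy with h' | h'
        · exact absurd (h'.1 ▸ h) haS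
        · exact h'
    by_cases hN2 : ∃ y ∈ P₂.support, G.Adj c y
    · exact no_attach hOH P₂ P₃ T T' i2 i3 hT hT' p23 h12 h13 h23 hb12 hb13 hb23 n3
        hT2 hT3 hT2' hT3' hc23.1 hc23.2 hca hcb hca₂ hca₃ hcb₂ hN2 hE₂ hE₃ P₁.length hKmin
        (by omega) (by omega)
    · have hN3 : ∃ y ∈ P₃.support, G.Adj c y := by
        by_contra hN3
        push Not at hN2 hN3
        exact hcN ⟨hN2, hN3⟩
      exact no_attach hOH P₃ P₂ T T' i3 i2 hT hT' (priPair_symm p23) h13 h12 h23.symm hb13 hb12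
        hb23.symm n2
        hT3 hT2 hT3' hT2' hc23.2 hc23.1 hca hcb hca₃ hca₂ hcb₃ hN3 hE₃ hE₂ P₁.length
        (fun S hS => by have := hKmin S hS; omega)
        (by omega) (by omega)
end

section
/- Let R be a subdivision of K4 and let F be the line-graph of R. Then either R = K4, or F contains an odd hole, or R is a bipartite graph. -/
open SimpleGraph

/-- Two walks meet exactly in the vertex `e`. -/
def MeetOnly {W : Type*} (R : SimpleGraph W) (e : W) {a b c d : W}
    (P : R.Walk a b) (Q : R.Walk c d) : Prop :=
  ∀ x : W, x ∈ P.support → x ∈ Q.support → x = e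

/-- Two walks are vertex-disjoint. -/
def DisjW {W : Type*} (R : SimpleGraph W) {a b c d : W}
    (P : R.Walk a b) (Q : R.Walk c d) : Prop :=
  ∀ x : W, x ∈ P.support → x ∉ Q.support

/-- `R` is a subdivision of `K₄`: there are four branch vertices `a, b, c, d` and six
internally disjoint paths joining them (one for each pair), which together cover all
vertices and all edges of `R`. -/
def IsSubdivK4 {W : Type*} (R : SimpleGraph W) : Prop :=
  ∃ (a b c d : W) (Pab : R.Walk a b) (Pac : R.Walk a c) (Pad : R.Walk a d)
    (Pbc : R.Walk b c) (Pbd : R.Walk b d) (Pcd : R.Walk c d),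
    a ≠ b ∧ a ≠ c ∧ a ≠ d ∧ b ≠ c ∧ b ≠ d ∧ c ≠ d ∧
    Pab.IsPath ∧ Pac.IsPath ∧ Pad.IsPath ∧ Pbc.IsPath ∧ Pbd.IsPath ∧ Pcd.IsPath ∧
    MeetOnly R a Pab Pac ∧ MeetOnly R a Pab Pad ∧ MeetOnly R a Pac Pad ∧
    MeetOnly R b Pab Pbc ∧ MeetOnly R b Pab Pbd ∧ MeetOnly R b Pbc Pbd ∧
    MeetOnly R c Pac Pbc ∧ MeetOnly R c Pac Pcd ∧ MeetOnly R c Pbc Pcd ∧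
    MeetOnly R d Pad Pbd ∧ MeetOnly R d Pad Pcd ∧ MeetOnly R d Pbd Pcd ∧
    DisjW R Pab Pcd ∧ DisjW R Pac Pbd ∧ DisjW R Pad Pbc ∧
    (∀ x : W, x ∈ Pab.support ∨ x ∈ Pac.support ∨ x ∈ Pad.support ∨
      x ∈ Pbc.support ∨ x ∈ Pbd.support ∨ x ∈ Pcd.support) ∧
    (∀ x y : W, R.Adj x y →
      Pab.toSubgraph.Adj x y ∨ Pac.toSubgraph.Adj x y ∨ Pad.toSubgraph.Adj x y ∨
      Pbc.toSubgraph.Adj x y ∨ Pbd.toSubgraph.Adj x y ∨ Pcd.toSubgraph.Adj x y)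

/-- The cycle graph embeds in its own line graph. -/
lemma cyc_embeds_line (n : ℕ) :
    Nonempty (cycleGraph (n + 4) ↪g (cycleGraph (n + 4)).lineGraph) := by
  have hadj : ∀ i : Fin (n + 4), (cycleGraph (n + 4)).Adj i (i + 1) := by
    intro i
    rw [cycleGraph_adj]
    right
    abel
  have h10 : (1 : Fin (n + 4)) + 1 ≠ 0 := by
    intro h
    have := congrArg Fin.val h
    simp [Fin.val_add] at this
    rw [Nat.mod_eq_of_lt (by omega)] at this
    omega
  have hinj : ∀ i j : Fin (n + 4), s(i, i + 1) = s(j, j + 1) → i = j := by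
    intro i j h
    rw [Sym2.eq_iff] at h
    rcases h with h | h
    · exact h.1
    · exfalso
      apply h10
      have h1 := h.1
      have h2 := h.2
      rw [h1] at h2
      have : j + (1 + 1) = j + 0 := by rw [← add_assoc, h2, add_zero]
      exact add_left_cancel this
  refine ⟨⟨⟨fun i => ⟨s(i, i + 1), hadj i⟩, ?_⟩, ?_⟩⟩
  · intro i j h
    exact hinj i j (congrArg Subtype.val h)
  · intro i j
    change (cycleGraph (n + 4)).lineGraph.Adj ⟨s(i, i + 1), hadj i⟩ ⟨s(j, j + 1), hadj j⟩ ↔ _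
    simp only [lineGraph_adj_iff_exists, cycleGraph_adj]
    constructor
    · rintro ⟨hne, v, hv1, hv2⟩
      have hij : i ≠ j := by
        rintro rfl
        exact hne rfl
      simp only [Sym2.mem_iff] at hv1 hv2
      rcases hv1 with rfl | rfl <;> rcases hv2 with h | h
      · exact absurd h hij
      · left
        rw [h]; abel
      · right
        rw [← h]; abel
      · exact absurd (add_right_cancel h) hij
    · intro h
      refine ⟨?_, ?_⟩
      · intro he
        have := hinj i j (congrArg Subtype.val he)
        subst this
        simp at h
      · rcases h with h | h
        · refine ⟨i, ?_, ?_⟩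
          · simp
          · have : i = j + 1 := by rw [← h]; abel
            simp [this]
        · refine ⟨j, ?_, ?_⟩
          · have : j = i + 1 := by rw [← h]; abel
            simp [this]
          · simp

/-- All edges of the cycle graph lie on its canonical cycle. -/
lemma cyc_adj_mem (n : ℕ) (i j : Fin (n + 3)) (h : (cycleGraph (n + 3)).Adj i j) :
    (cycleGraph.cycle n).toSubgraph.Adj i j := by
  have key : ∀ i : Fin (n + 3), (cycleGraph.cycle n).toSubgraph.Adj (i + 1) i := by
    intro i
    rw [Walk.toSubgraph_adj_iff]
    refine ⟨n + 2 - i.val, ?_, ?_⟩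
    · have hi := i.isLt
      rw [cycleGraph.getVert_cycle (by omega), cycleGraph.getVert_cycle (by omega)]
      have e1 : (⟨(n + 3 - (n + 2 - i.val)) % (n + 3), Nat.mod_lt _ (by omega)⟩ : Fin (n + 3))
          = i + 1 := by
        apply Fin.ext
        simp only [Fin.val_add, Fin.val_one]
        congr 1
        omega
      have e2 : (⟨(n + 3 - (n + 2 - i.val + 1)) % (n + 3), Nat.mod_lt _ (by omega)⟩ : Fin (n + 3))
          = i := by
        apply Fin.ext
        simp only
        rw [show n + 3 - (n + 2 - i.val + 1) = i.val by omega]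
        exact Nat.mod_eq_of_lt hi
      rw [e1, e2]
    · simp only [cycleGraph.length_cycle]
      omega
  rw [cycleGraph_adj] at h
  rcases h with h | h
  · have : i = j + 1 := by rw [← h]; abel
    rw [this]; exact key j
  · have : j = i + 1 := by rw [← h]; abel
    rw [this]; exact (key i).symm

lemma oddHole_of_cycle {W : Type*} {R : SimpleGraph W} {v : W} (c : R.Walk v v)
    (hc : c.IsCycle) (hl : 4 ≤ c.length) (ho : Odd c.length) : HasOddHole R.lineGraph := by
  obtain ⟨n, hn⟩ : ∃ n, c.length = n + 4 := ⟨c.length - 4, by omega⟩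
  have h1 : cycleGraph (n + 4) ⊑ R :=
    (cycleGraph_isContained_iff (by omega)).2 ⟨v, c, hc, hn⟩
  obtain ⟨g1⟩ := h1.isIndContained_lineGraph
  obtain ⟨g2⟩ := cyc_embeds_line n
  let g : cycleGraph (n + 1 + 3) ↪g R.lineGraph := g2.trans g1
  refine ⟨_, (cycleGraph.cycle (n + 1)).map g.toHom, ⟨?_, ?_, ?_⟩, ?_⟩
  · exact (Walk.isCycle_map_iff_of_injective g.injective).mpr cycleGraph.isCycle_cycle
  · simp
  · intro x y hx hy hxy
    rw [Walk.support_map, List.mem_map] at hx hy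
    obtain ⟨i, -, rfl⟩ := hx
    obtain ⟨j, -, rfl⟩ := hy
    have hij : (cycleGraph (n + 1 + 3)).Adj i j := g.map_adj_iff.1 hxy
    rw [Walk.toSubgraph_map, Subgraph.map_adj]
    exact ⟨i, j, cyc_adj_mem (n + 1) i j hij, rfl, rfl⟩
  · simp only [Walk.length_map, cycleGraph.length_cycle]
    rw [hn] at ho
    exact ho

lemma isPath_append_of_meet {W : Type*} {R : SimpleGraph W} {u v w : W} {p : R.Walk u v}
    {q : R.Walk v w} (hp : p.IsPath) (hq : q.IsPath) (hm : MeetOnly R v p q) :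
    (p.append q).IsPath := by
  rw [Walk.isPath_def, Walk.support_append, List.nodup_append']
  refine ⟨hp.support_nodup, hq.support_nodup.tail, ?_⟩
  intro x hx hy
  have := hm x hx (List.mem_of_mem_tail hy)
  subst this
  have h := hq.support_nodup
  rw [← Walk.cons_tail_support] at h
  exact (List.nodup_cons.1 h).1 hy

/-- Two paths with common ends meeting only at the ends yield an even closed walk,
or one of length three, unless there is an odd hole. -/
lemma even_or_three {W : Type*} {R : SimpleGraph W} (hno : ¬ HasOddHole R.lineGraph) {u v : W}
    (p : R.Walk u v) (q : R.Walk v u) (hp : p.IsPath) (hq : q.IsPath)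
    (hm : ∀ x, x ∈ p.support → x ∈ q.support → x = u ∨ x = v) :
    Even (p.length + q.length) ∨ p.length + q.length = 3 ∨ p.length + q.length = 1 := by
  by_contra hcon
  push Not at hcon
  obtain ⟨h1, h2, h3⟩ := hcon
  rw [Nat.not_even_iff_odd] at h1
  have h4 : 5 ≤ p.length + q.length := by
    obtain ⟨k, hk⟩ := h1
    omega
  apply hno
  refine oddHole_of_cycle (p.append q) (hp.isCycle_append hq ?_ (by omega)) ?_ ?_
  · intro x hx hx'
    rcases hm x (List.mem_of_mem_tail hx) (List.mem_of_mem_tail hx') with rfl | rfl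
    · have h := hp.support_nodup
      rw [← Walk.cons_tail_support] at h
      exact (List.nodup_cons.1 h).1 hx
    · have h := hq.support_nodup
      rw [← Walk.cons_tail_support] at h
      exact (List.nodup_cons.1 h).1 hx'
  · rw [Walk.length_append]; omega
  · rw [Walk.length_append]; exact h1

lemma tri_even {W : Type*} {R : SimpleGraph W} (hno : ¬ HasOddHole R.lineGraph) {u v w : W}
    (p : R.Walk u v) (q : R.Walk v w) (r : R.Walk u w) (hp : p.IsPath) (hq : q.IsPath)
    (hr : r.IsPath) (h1 : MeetOnly R v p q) (h2 : MeetOnly R u p r) (h3 : MeetOnly R w r q) :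
    Even (p.length + q.length + r.length) ∨ p.length + q.length + r.length = 3 ∨
      p.length + q.length + r.length = 1 := by
  have := even_or_three hno (p.append q) r.reverse (isPath_append_of_meet hp hq h1) hr.reverse
    (by
      intro x hx hx'
      rw [Walk.support_reverse, List.mem_reverse] at hx'
      rw [Walk.mem_support_append_iff] at hx
      rcases hx with hx | hx
      · exact Or.inl (h2 x hx hx')
      · exact Or.inr (h3 x hx' hx))
  simpa using this

lemma quad_even {W : Type*} {R : SimpleGraph W} (hno : ¬ HasOddHole R.lineGraph) {u v w z : W}
    (p : R.Walk u v) (q : R.Walk v w) (r : R.Walk u z) (s : R.Walk z w) (hp : p.IsPath)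
    (hq : q.IsPath) (hr : r.IsPath) (hs : s.IsPath)
    (h1 : MeetOnly R v p q) (h2 : MeetOnly R u p r) (h3 : MeetOnly R w q s)
    (h4 : MeetOnly R z r s) (h5 : DisjW R p s) (h6 : DisjW R q r) :
    Even (p.length + q.length + (r.length + s.length)) ∨
      p.length + q.length + (r.length + s.length) = 3 ∨
      p.length + q.length + (r.length + s.length) = 1 := by
  have := even_or_three hno (p.append q) (r.append s).reverse (isPath_append_of_meet hp hq h1)
    (isPath_append_of_meet hr hs h4).reverse
    (by
      intro x hx hx'
      rw [Walk.support_reverse, List.mem_reverse, Walk.mem_support_append_iff] at hx'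
      rw [Walk.mem_support_append_iff] at hx
      rcases hx with hx | hx <;> rcases hx' with hx' | hx'
      · exact Or.inl (h2 x hx hx')
      · exact absurd hx' (h5 x hx)
      · exact absurd hx' (h6 x hx)
      · exact Or.inr (h3 x hx hx'))
  rw [Walk.length_append, Walk.length_reverse, Walk.length_append] at this
  exact this

/-- A path can be coloured alternately from any starting colour. -/
lemma path_col {W : Type*} [DecidableEq W] {R : SimpleGraph W} {u v : W} (p : R.Walk u v)
    (hp : p.IsPath) (k : ZMod 2) : ∃ f : W → ZMod 2, f u = k ∧ f v = k + p.length ∧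
      ∀ x y, p.toSubgraph.Adj x y → f x ≠ f y := by
  refine ⟨fun x => k + (p.support.idxOf x : ℕ), ?_, ?_, ?_⟩
  · have : p.support.idxOf u = 0 := by
      rw [← Walk.cons_tail_support, List.idxOf_cons_self]
    simp only [this]
    simp
  · have : p.support.idxOf v = p.length := by
      have h := hp.support_nodup.idxOf_getElem p.length (by simp)
      simpa using h
    simp only [this]
  · have key : ∀ i, i < p.length → p.support.idxOf (p.getVert i) = i := by
      intro i hi
      have h := hp.support_nodup.idxOf_getElem i (by simp; omega)
      rwa [Walk.support_getElem_eq_getVert] at h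
    have key' : ∀ i, i ≤ p.length → p.support.idxOf (p.getVert i) = i := by
      intro i hi
      have h := hp.support_nodup.idxOf_getElem i (by simp; omega)
      rwa [Walk.support_getElem_eq_getVert] at h
    have h2 : ∀ t : ZMod 2, t ≠ t + 1 := by decide
    intro x y hxy
    rw [Walk.toSubgraph_adj_iff] at hxy
    obtain ⟨i, hi, hlt⟩ := hxy
    rw [Sym2.eq_iff] at hi
    rcases hi with ⟨rfl, rfl⟩ | ⟨rfl, rfl⟩
    · simp only [key' i hlt.le, key' (i + 1) hlt]
      push_cast
      rw [← add_assoc]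
      exact h2 _
    · simp only [key' i hlt.le, key' (i + 1) hlt]
      push_cast
      rw [← add_assoc]
      exact (h2 _).symm

lemma zmod_aux : ∀ r s t : ZMod 2, r + s + t = 0 → r + s = t := by decide

lemma len_pos {W : Type*} {R : SimpleGraph W} {u v : W} (p : R.Walk u v) (h : u ≠ v) :
    1 ≤ p.length := by
  rcases Nat.eq_zero_or_pos p.length with h0 | h0
  · exact absurd (Walk.eq_of_length_eq_zero h0) h
  · exact h0

lemma supp_of_len_one {W : Type*} {R : SimpleGraph W} {u v : W} (p : R.Walk u v)
    (h : p.length = 1) (x : W) (hx : x ∈ p.support) : x = u ∨ x = v := by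
  cases p with
  | nil => simp at h
  | cons h' q =>
    cases q with
    | nil => simpa using hx
    | cons h'' q => simp at h

lemma isK4 {W : Type*} {R : SimpleGraph W} (a b c d : W) (hab : R.Adj a b) (hac : R.Adj a c)
    (had : R.Adj a d) (hbc : R.Adj b c) (hbd : R.Adj b d) (hcd : R.Adj c d)
    (hall : ∀ x, x = a ∨ x = b ∨ x = c ∨ x = d) :
    Nonempty (R ≃g (⊤ : SimpleGraph (Fin 4))) := by
  let f : Fin 4 → W := ![a, b, c, d]
  have hf : ∀ i j, i ≠ j → R.Adj (f i) (f j) := by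
    intro i j hij
    fin_cases i <;> fin_cases j <;>
      first
      | exact absurd rfl hij
      | assumption
      | (apply SimpleGraph.Adj.symm; assumption)
  have hinj : Function.Injective f := by
    intro i j h
    by_contra hij
    exact (hf i j hij).ne h
  have hsurj : Function.Surjective f := by
    intro x
    rcases hall x with rfl | rfl | rfl | rfl
    · exact ⟨0, rfl⟩
    · exact ⟨1, rfl⟩
    · exact ⟨2, rfl⟩
    · exact ⟨3, rfl⟩
  let e : (⊤ : SimpleGraph (Fin 4)) ≃g R :=
    { toEquiv := Equiv.ofBijective f ⟨hinj, hsurj⟩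
      map_rel_iff' := by
        intro i j
        simp only [top_adj]
        exact ⟨fun h hij => h.ne (congrArg f hij), hf i j⟩ }
  exact ⟨e.symm⟩

/-- If `R` is a subdivision of `K₄` and `F` is the line-graph of `R`,
then either `R = K₄`, or `F` contains an odd hole, or `R` is bipartite. -/
theorem lineGraph_subdivK4_trichotomy
    {W : Type*} [Fintype W] [DecidableEq W] (R : SimpleGraph W) (h : IsSubdivK4 R) :
    Nonempty (R ≃g (⊤ : SimpleGraph (Fin 4))) ∨
    HasOddHole R.lineGraph ∨
    R.Colorable 2 := by
  obtain ⟨a, b, c, d, Pab, Pac, Pad, Pbc, Pbd, Pcd, nab, nac, nad, nbc, nbd, ncd,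
    iab, iac, iad, ibc, ibd, icd, a1, a2, a3, b1, b2, b3, c1, c2, c3, d1, d2, d3,
    e1, e2, e3, hcov, hadj⟩ := h
  by_cases hno : HasOddHole R.lineGraph
  · exact Or.inr (Or.inl hno)
  have t1 := tri_even hno Pab Pbc Pac iab ibc iac b1 a1 c1
  have t2 := tri_even hno Pab Pbd Pad iab ibd iad b2 a2 d1
  have t3 := tri_even hno Pac Pcd Pad iac icd iad c2 a3 d2
  have t4 := tri_even hno Pbc Pcd Pbd ibc icd ibd c3 b3 d3
  have sw : ∀ {e x y z t : W} {P : R.Walk x y} {Q : R.Walk z t}, MeetOnly R e P Q →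
      MeetOnly R e Q P := fun hm x h1 h2 => hm x h2 h1
  have swd : ∀ {x y z t : W} {P : R.Walk x y} {Q : R.Walk z t}, DisjW R P Q →
      DisjW R Q P := fun hm x h1 h2 => hm x h2 h1
  -- quadrilaterals abcd, abdc, acbd
  have q1 := quad_even hno Pab Pbc Pad Pcd.reverse iab ibc iad icd.reverse b1 a2
    (by intro x hx hx'; exact c3 x hx (by simpa using hx'))
    (by intro x hx hx'; exact d2 x hx (by simpa using hx'))
    (by intro x hx hx'; exact e1 x hx (by simpa using hx'))
    (swd e3)
  have q2 := quad_even hno Pab Pbd Pac Pcd iab ibd iac icd b2 a1 d3 c2 e1 (swd e2)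
  have q3 := quad_even hno Pac Pbc.reverse Pad Pbd.reverse iac ibc.reverse iad ibd.reverse
    (by intro x hx hx'; exact c1 x hx (by simpa using hx'))
    a3
    (by intro x hx hx'; exact b3 x (by simpa using hx) (by simpa using hx'))
    (by intro x hx hx'; exact d1 x hx (by simpa using hx'))
    (by intro x hx hx'; exact e2 x hx (by simpa using hx'))
    (by intro x hx hx'; exact e3 x hx' (by simpa using hx))
  simp only [Walk.length_reverse] at q1 q3
  have l1 := len_pos Pab nab
  have l2 := len_pos Pac nac
  have l3 := len_pos Pad nad
  have l4 := len_pos Pbc nbc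
  have l5 := len_pos Pbd nbd
  have l6 := len_pos Pcd ncd
  by_cases hev : Even (Pab.length + Pbc.length + Pac.length) ∧
      Even (Pab.length + Pbd.length + Pad.length) ∧
      Even (Pac.length + Pcd.length + Pad.length) ∧ Even (Pbc.length + Pcd.length + Pbd.length)
  · right; right
    obtain ⟨v1, v2, v3, -⟩ := hev
    have z1 : (Pab.length : ZMod 2) + Pbc.length = Pac.length := by
      have := (ZMod.natCast_eq_zero_iff_even).2 v1
      push_cast at this
      exact zmod_aux _ _ _ this
    have z2 : (Pab.length : ZMod 2) + Pbd.length = Pad.length := by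
      have := (ZMod.natCast_eq_zero_iff_even).2 v2
      push_cast at this
      exact zmod_aux _ _ _ this
    have z3 : (Pac.length : ZMod 2) + Pcd.length = Pad.length := by
      have := (ZMod.natCast_eq_zero_iff_even).2 v3
      push_cast at this
      exact zmod_aux _ _ _ this
    obtain ⟨f1, f1a, f1b, f1c⟩ := path_col Pab iab 0
    obtain ⟨f2, f2a, f2b, f2c⟩ := path_col Pac iac 0
    obtain ⟨f3, f3a, f3b, f3c⟩ := path_col Pad iad 0
    obtain ⟨f4, f4a, f4b, f4c⟩ := path_col Pbc ibc Pab.length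
    obtain ⟨f5, f5a, f5b, f5c⟩ := path_col Pbd ibd Pab.length
    obtain ⟨f6, f6a, f6b, f6c⟩ := path_col Pcd icd Pac.length
    rw [zero_add] at f1b f2b f3b
    rw [z1] at f4b
    rw [z2] at f5b
    rw [z3] at f6b
    have hex : ∀ x, ∃ k : ZMod 2, (x ∈ Pab.support → k = f1 x) ∧ (x ∈ Pac.support → k = f2 x) ∧
        (x ∈ Pad.support → k = f3 x) ∧ (x ∈ Pbc.support → k = f4 x) ∧
        (x ∈ Pbd.support → k = f5 x) ∧ (x ∈ Pcd.support → k = f6 x) := by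
      intro x
      have a1 := a1 x
      have a2 := a2 x
      have a3 := a3 x
      have b1 := b1 x
      have b2 := b2 x
      have b3 := b3 x
      have c1 := c1 x
      have c2 := c2 x
      have c3 := c3 x
      have d1 := d1 x
      have d2 := d2 x
      have d3 := d3 x
      have e1 := e1 x
      have e2 := e2 x
      have e3 := e3 x
      rcases hcov x with hx | hx | hx | hx | hx | hx
      · exact ⟨f1 x, by grind⟩
      · exact ⟨f2 x, by grind⟩
      · exact ⟨f3 x, by grind⟩
      · exact ⟨f4 x, by grind⟩
      · exact ⟨f5 x, by grind⟩
      · exact ⟨f6 x, by grind⟩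
    choose g g1 g2 g3 g4 g5 g6 using hex
    have hg : ∀ x y, R.Adj x y → g x ≠ g y := by
      intro x y hxy
      rcases hadj x y hxy with hh | hh | hh | hh | hh | hh
      · rw [g1 x (Walk.mem_support_of_adj_toSubgraph hh),
          g1 y (Walk.mem_support_of_adj_toSubgraph hh.symm)]
        exact f1c x y hh
      · rw [g2 x (Walk.mem_support_of_adj_toSubgraph hh),
          g2 y (Walk.mem_support_of_adj_toSubgraph hh.symm)]
        exact f2c x y hh
      · rw [g3 x (Walk.mem_support_of_adj_toSubgraph hh),
          g3 y (Walk.mem_support_of_adj_toSubgraph hh.symm)]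
        exact f3c x y hh
      · rw [g4 x (Walk.mem_support_of_adj_toSubgraph hh),
          g4 y (Walk.mem_support_of_adj_toSubgraph hh.symm)]
        exact f4c x y hh
      · rw [g5 x (Walk.mem_support_of_adj_toSubgraph hh),
          g5 y (Walk.mem_support_of_adj_toSubgraph hh.symm)]
        exact f5c x y hh
      · rw [g6 x (Walk.mem_support_of_adj_toSubgraph hh),
          g6 y (Walk.mem_support_of_adj_toSubgraph hh.symm)]
        exact f6c x y hh
    exact ⟨Coloring.mk (α := Fin 2) g (fun {x y} hxy => hg x y hxy)⟩
  · left
    simp only [Nat.even_iff] at *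
    have hlen : Pab.length = 1 ∧ Pac.length = 1 ∧ Pad.length = 1 ∧ Pbc.length = 1 ∧
        Pbd.length = 1 ∧ Pcd.length = 1 := by
      omega
    obtain ⟨m1, m2, m3, m4, m5, m6⟩ := hlen
    refine isK4 a b c d (Walk.adj_of_length_eq_one m1) (Walk.adj_of_length_eq_one m2)
      (Walk.adj_of_length_eq_one m3) (Walk.adj_of_length_eq_one m4)
      (Walk.adj_of_length_eq_one m5) (Walk.adj_of_length_eq_one m6) ?_
    intro x
    rcases hcov x with hx | hx | hx | hx | hx | hx
    · rcases supp_of_len_one _ m1 x hx with h | h <;> simp [h]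
    · rcases supp_of_len_one _ m2 x hx with h | h <;> simp [h]
    · rcases supp_of_len_one _ m3 x hx with h | h <;> simp [h]
    · rcases supp_of_len_one _ m4 x hx with h | h <;> simp [h]
    · rcases supp_of_len_one _ m5 x hx with h | h <;> simp [h]
    · rcases supp_of_len_one _ m6 x hx with h | h <;> simp [h]
end

section
/- Let G be a simple graph that contains no odd hole and no induced subgraph that is the line-graph of a proper subdivision of K4. Let H be an induced prism in G, formed by chordless paths P1, P2, P3 with triangles {a1,a2,a3} and {b1,b2,b3}, where Pi joins ai to bi. Let P be any chordless path of G from a1 to b1 whose interior vertices are not adjacent to a2, a3, b2, b3. Then the three paths P, P2, P3 form an induced prism of G of the same parity as H (in particular, P has the same length parity as P1). -/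
open SimpleGraph

/-- Two rungs whose basic triangles share a branch vertex: they are vertex-disjoint and
the only edge between them is the triangle edge `c₁c₂`. -/
def RungShare {V : Type*} (G : SimpleGraph V) (c₁ c₂ : V) {w x y z : V}
    (P : G.Walk w x) (Q : G.Walk y z) : Prop :=
  (∀ v : V, v ∈ P.support → v ∉ Q.support) ∧
  (∀ u ∈ P.support, ∀ v ∈ Q.support, G.Adj u v → u = c₁ ∧ v = c₂)

/-- Two opposite rungs: vertex-disjoint with no edge between them. -/
def RungOpp {V : Type*} (G : SimpleGraph V) {w x y z : V}
    (P : G.Walk w x) (Q : G.Walk y z) : Prop :=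
  (∀ v : V, v ∈ P.support → v ∉ Q.support) ∧
  (∀ u ∈ P.support, ∀ v ∈ Q.support, ¬ G.Adj u v)

/-- An induced subgraph of `G` that is the line-graph of a subdivision of `K₄`,
described by its twelve corners (the vertices of the four basic triangles `T_a, T_b,
T_c, T_d`) and its six rungs (chordless paths, `Rxy` joining `v_xy ∈ T_x` to
`v_yx ∈ T_y`, possibly of length `0`); there are no edges besides those of the four
basic triangles and of the six rungs. -/
structure LGSK4 {V : Type*} (G : SimpleGraph V) where
  vab : V
  vac : V
  vad : V
  vba : V
  vbc : V
  vbd : V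
  vca : V
  vcb : V
  vcd : V
  vda : V
  vdb : V
  vdc : V
  Rab : G.Walk vab vba
  Rac : G.Walk vac vca
  Rad : G.Walk vad vda
  Rbc : G.Walk vbc vcb
  Rbd : G.Walk vbd vdb
  Rcd : G.Walk vcd vdc
  ind_ab : IsInducedPathW G Rab
  ind_ac : IsInducedPathW G Rac
  ind_ad : IsInducedPathW G Rad
  ind_bc : IsInducedPathW G Rbc
  ind_bd : IsInducedPathW G Rbd
  ind_cd : IsInducedPathW G Rcd
  tri_a : G.Adj vab vac ∧ G.Adj vab vad ∧ G.Adj vac vad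
  tri_b : G.Adj vba vbc ∧ G.Adj vba vbd ∧ G.Adj vbc vbd
  tri_c : G.Adj vca vcb ∧ G.Adj vca vcd ∧ G.Adj vcb vcd
  tri_d : G.Adj vda vdb ∧ G.Adj vda vdc ∧ G.Adj vdb vdc
  share_ab_ac : RungShare G vab vac Rab Rac
  share_ab_ad : RungShare G vab vad Rab Rad
  share_ac_ad : RungShare G vac vad Rac Rad
  share_ab_bc : RungShare G vba vbc Rab Rbc
  share_ab_bd : RungShare G vba vbd Rab Rbd
  share_bc_bd : RungShare G vbc vbd Rbc Rbd
  share_ac_bc : RungShare G vca vcb Rac Rbc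
  share_ac_cd : RungShare G vca vcd Rac Rcd
  share_bc_cd : RungShare G vcb vcd Rbc Rcd
  share_ad_bd : RungShare G vda vdb Rad Rbd
  share_ad_cd : RungShare G vda vdc Rad Rcd
  share_bd_cd : RungShare G vdb vdc Rbd Rcd
  opp_ab_cd : RungOpp G Rab Rcd
  opp_ac_bd : RungOpp G Rac Rbd
  opp_ad_bc : RungOpp G Rad Rbc

/-- The vertex set of an induced line-graph of a subdivision of `K₄`. -/
def LGSK4.verts {V : Type*} [DecidableEq V] {G : SimpleGraph V} (D : LGSK4 G) : Finset V :=
  D.Rab.support.toFinset ∪ D.Rac.support.toFinset ∪ D.Rad.support.toFinset ∪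
    D.Rbc.support.toFinset ∪ D.Rbd.support.toFinset ∪ D.Rcd.support.toFinset

/-- The subdivision is *proper*: at least one edge of `K₄` is subdivided, i.e. at
least one rung has length at least `1`. -/
def LGSK4.Proper {V : Type*} {G : SimpleGraph V} (D : LGSK4 G) : Prop :=
  1 ≤ D.Rab.length ∨ 1 ≤ D.Rac.length ∨ 1 ≤ D.Rad.length ∨
  1 ≤ D.Rbc.length ∨ 1 ≤ D.Rbd.length ∨ 1 ≤ D.Rcd.length

/-- `G` has an induced subgraph on the vertex set `S` that is the line-graph of a
proper subdivision of `K₄`. -/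
def HasLGPSK4On {V : Type*} [DecidableEq V] (G : SimpleGraph V) (S : Finset V) : Prop :=
  ∃ D : LGSK4 G, D.Proper ∧ D.verts = S



namespace PrismAux

variable {V : Type*} {G : SimpleGraph V}

/-- There is a chordless path from `u` to `v` with vertex set `S` and length `n`. -/
def IP (G : SimpleGraph V) (u v : V) (S : Set V) (n : ℕ) : Prop :=
  ∃ p : G.Walk u v, IsInducedPathW G p ∧ p.length = n ∧ ∀ x, x ∈ p.support ↔ x ∈ S

lemma ind_iff {u v : V} (p : G.Walk u v) : IsInducedPathW G p ↔
    p.IsPath ∧ ∀ x y : V, x ∈ p.support → y ∈ p.support → G.Adj x y → s(x, y) ∈ p.edges := by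
  unfold IsInducedPathW
  simp only [← Walk.mem_edges_toSubgraph, Subgraph.mem_edgeSet]

lemma isPath_nil {u : V} (p : G.Walk u u) (h : p.IsPath) : p = Walk.nil := by
  cases p with
  | nil => rfl
  | cons h' p =>
    rw [Walk.cons_isPath_iff] at h
    exact absurd p.end_mem_support h.2

lemma ind_rev {u v : V} {p : G.Walk u v} (h : IsInducedPathW G p) :
    IsInducedPathW G p.reverse := by
  rw [ind_iff] at *
  simpa using h

lemma path_append_mid {u v w : V} {p : G.Walk u v} {q : G.Walk v w}
    (h : (p.append q).IsPath) {x : V} (hp : x ∈ p.support) (hq : x ∈ q.support) : x = v := by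
  have h1 := h.support_nodup
  rw [Walk.support_append] at h1
  rw [Walk.mem_support_iff] at hq
  rcases hq with rfl | hq
  · rfl
  · exact absurd hq (List.disjoint_of_nodup_append h1 hp)

lemma ind_left {u v w : V} {p : G.Walk u v} {q : G.Walk v w}
    (h : IsInducedPathW G (p.append q)) : IsInducedPathW G p := by
  rw [ind_iff] at *
  obtain ⟨h1, h2⟩ := h
  refine ⟨h1.of_append_left, fun x y hx hy hxy => ?_⟩
  have := h2 x y (by simp [hx]) (by simp [hy]) hxy
  rw [Walk.edges_append, List.mem_append] at this
  rcases this with h | h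
  · exact h
  · have e1 := path_append_mid h1 hx (q.fst_mem_support_of_mem_edges h)
    have e2 := path_append_mid h1 hy (q.snd_mem_support_of_mem_edges h)
    subst e1
    exact absurd (e2 ▸ hxy) (G.irrefl)

lemma ind_right {u v w : V} {p : G.Walk u v} {q : G.Walk v w}
    (h : IsInducedPathW G (p.append q)) : IsInducedPathW G q := by
  have := ind_rev h
  rw [Walk.reverse_append] at this
  have := ind_rev (ind_left this)
  simpa using this

lemma IP.rev {u v : V} {S : Set V} {n : ℕ} (h : IP G u v S n) : IP G v u S n := by
  obtain ⟨p, h1, h2, h3⟩ := h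
  exact ⟨p.reverse, ind_rev h1, by simpa using h2, by simpa using h3⟩

lemma IP.fst {u v : V} {S : Set V} {n : ℕ} (h : IP G u v S n) : u ∈ S := by
  obtain ⟨p, h1, h2, h3⟩ := h
  exact (h3 _).1 (by simp)

lemma IP.snd {u v : V} {S : Set V} {n : ℕ} (h : IP G u v S n) : v ∈ S := h.rev.fst

lemma IP.pos {u v : V} {S : Set V} {n : ℕ} (h : IP G u v S n) (hn : u ≠ v) : 1 ≤ n := by
  obtain ⟨p, h1, h2, h3⟩ := h
  cases p with
  | nil => exact absurd rfl hn
  | cons => simp at h2; omega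

lemma IP.single (u : V) : IP G u u {u} 0 := by
  refine ⟨Walk.nil, ?_, rfl, by simp⟩
  rw [ind_iff]
  refine ⟨by simp, fun x y hx hy hxy => ?_⟩
  simp at hx hy
  subst hx; subst hy
  exact absurd hxy (G.irrefl)

lemma IP.glue {u v w z : V} {S T : Set V} {m n : ℕ} (h : IP G u v S m) (h' : IP G w z T n)
    (ha : G.Adj v w) (hST : ∀ x ∈ S, ∀ y ∈ T, x ≠ y ∧ (G.Adj x y → x = v ∧ y = w)) :
    IP G u z (S ∪ T) (m + n + 1) := by
  obtain ⟨p, h1, h2, h3⟩ := h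
  obtain ⟨q, k1, k2, k3⟩ := h'
  rw [ind_iff] at *
  have hs : ∀ x, x ∈ (p.append (Walk.cons ha q)).support ↔ x ∈ S ∪ T := by
    intro x
    rw [Walk.mem_support_append_iff, Walk.support_cons, List.mem_cons, Set.mem_union, h3, k3]
    have : v ∈ S := (h3 v).1 (by simp)
    constructor
    · rintro (h | rfl | h) <;> tauto
    · tauto
  refine ⟨p.append (Walk.cons ha q), ?_, by simp; omega, hs⟩
  rw [ind_iff]
  constructor
  · rw [Walk.isPath_def, Walk.support_append, Walk.support_cons, List.tail_cons,
      List.nodup_append]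
    refine ⟨h1.1.support_nodup, k1.1.support_nodup, fun x hx y hy => ?_⟩
    exact (hST x ((h3 x).1 hx) y ((k3 y).1 hy)).1
  · intro x y hx hy hxy
    rw [hs] at hx hy
    rw [Walk.edges_append, Walk.edges_cons, List.mem_append, List.mem_cons]
    rcases hx with hx | hx <;> rcases hy with hy | hy
    · exact Or.inl (h1.2 x y ((h3 _).2 hx) ((h3 _).2 hy) hxy)
    · obtain ⟨rfl, rfl⟩ := (hST x hx y hy).2 hxy
      simp
    · obtain ⟨rfl, rfl⟩ := (hST y hy x hx).2 hxy.symm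
      simp [Sym2.eq_swap]
    · exact Or.inr (Or.inr (k1.2 x y ((k3 _).2 hx) ((k3 _).2 hy) hxy))

lemma IP.hole (hO : ¬ HasOddHole G) {u v w z : V} {S T : Set V} {m n : ℕ}
    (h : IP G u v S m) (h' : IP G w z T n)
    (ha : G.Adj u w) (hb : G.Adj v z) (hmn : 2 ≤ m + n)
    (hST : ∀ x ∈ S, ∀ y ∈ T, x ≠ y ∧ (G.Adj x y → (x = u ∧ y = w) ∨ (x = v ∧ y = z))) :
    Even (m + n) := by
  by_contra hodd
  apply hO
  obtain ⟨p, h1, h2, h3⟩ := h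
  obtain ⟨q, k1, k2, k3⟩ := h'
  rw [ind_iff] at *
  let r : G.Walk u w := p.append (Walk.cons hb q.reverse)
  have hvS : v ∈ S := (h3 v).1 (by simp)
  have huS : u ∈ S := (h3 u).1 (by simp)
  have hwT : w ∈ T := (k3 w).1 (by simp)
  have hzT : z ∈ T := (k3 z).1 (by simp)
  have hs : ∀ x, x ∈ r.support ↔ x ∈ S ∪ T := by
    intro x
    simp only [r]
    rw [Walk.mem_support_append_iff, Walk.support_cons, List.mem_cons, Set.mem_union, h3,
      Walk.support_reverse, List.mem_reverse, k3]
    constructor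
    · rintro (h | rfl | h) <;> tauto
    · tauto
  have hs' : ∀ x, x ∈ (Walk.cons ha.symm r).support ↔ x ∈ S ∪ T := by
    intro x
    rw [Walk.support_cons, List.mem_cons, hs]
    constructor
    · rintro (rfl | h)
      · exact Or.inr hwT
      · exact h
    · tauto
  have hlen : (Walk.cons ha.symm r).length = m + n + 2 := by
    simp [r]; omega
  refine ⟨w, Walk.cons ha.symm r, ⟨?_, by omega, ?_⟩, ?_⟩
  · rw [Walk.cons_isCycle_iff]
    constructor
    · rw [Walk.isPath_def, Walk.support_append, Walk.support_cons, List.tail_cons,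
        List.nodup_append]
      refine ⟨h1.1.support_nodup, by simpa using k1.1.support_nodup, fun x hx y hy => ?_⟩
      rw [Walk.support_reverse, List.mem_reverse] at hy
      exact (hST x ((h3 x).1 hx) y ((k3 y).1 hy)).1
    · intro he
      rw [Walk.edges_append, Walk.edges_cons, List.mem_append, List.mem_cons,
        Walk.edges_reverse, List.mem_reverse] at he
      rcases he with he | he | he
      · have := p.fst_mem_support_of_mem_edges he
        exact (hST w ((h3 _).1 this) w hwT).1 rfl
      · rw [Sym2.eq_iff] at he
        rcases he with ⟨rfl, -⟩ | ⟨rfl, rfl⟩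
        · exact (hST w hvS w hwT).1 rfl
        · have e1 := isPath_nil p h1.1
          have e2 := isPath_nil q k1.1
          subst e1; subst e2
          simp at h2 k2
          omega
      · have := q.snd_mem_support_of_mem_edges he
        exact (hST u huS u ((k3 _).1 this)).1 rfl
  · intro x y hx hy hxy
    rw [← Subgraph.mem_edgeSet, Walk.mem_edges_toSubgraph]
    rw [hs'] at hx hy
    rw [Walk.edges_cons, Walk.edges_append, Walk.edges_cons, List.mem_cons, List.mem_append,
      List.mem_cons, Walk.edges_reverse, List.mem_reverse]
    rcases hx with hx | hx <;> rcases hy with hy | hy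
    · exact Or.inr (Or.inl (h1.2 x y ((h3 _).2 hx) ((h3 _).2 hy) hxy))
    · rcases (hST x hx y hy).2 hxy with ⟨rfl, rfl⟩ | ⟨rfl, rfl⟩
      · simp [Sym2.eq_swap]
      · simp
    · rcases (hST y hy x hx).2 hxy.symm with ⟨rfl, rfl⟩ | ⟨rfl, rfl⟩
      · simp
      · simp [Sym2.eq_swap]
    · exact Or.inr (Or.inr (Or.inr (k1.2 x y ((k3 _).2 hx) ((k3 _).2 hy) hxy)))
  · rw [hlen]
    rw [Nat.not_even_iff_odd] at hodd
    obtain ⟨k, hk⟩ := hodd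
    exact ⟨k + 1, by omega⟩

lemma first_hit {u v : V} (p : G.Walk u v) (N : V → Prop) (h : ∃ x ∈ p.support, N x) :
    ∃ (s : V) (q : G.Walk u s) (r : G.Walk s v), p = q.append r ∧ N s ∧
      ∀ x ∈ q.support, N x → x = s := by
  induction p with
  | nil =>
    obtain ⟨x, hx, hN⟩ := h
    simp at hx
    subst hx
    exact ⟨x, Walk.nil, Walk.nil, rfl, hN, by simp⟩
  | @cons a b c hab p ih =>
    by_cases ha : N a
    · exact ⟨a, Walk.nil, Walk.cons hab p, rfl, ha, by simp⟩
    · obtain ⟨x, hx, hN⟩ := h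
      rw [Walk.support_cons, List.mem_cons] at hx
      have hx : x ∈ p.support := by
        rcases hx with rfl | hx
        · exact absurd hN ha
        · exact hx
      obtain ⟨s, q, r, e, hs, hq⟩ := ih ⟨x, hx, hN⟩
      refine ⟨s, Walk.cons hab q, r, by rw [e]; rfl, hs, ?_⟩
      intro y hy hNy
      rw [Walk.support_cons, List.mem_cons] at hy
      rcases hy with rfl | hy
      · exact absurd hNy ha
      · exact hq y hy hNy

lemma last_hit {u v : V} (p : G.Walk u v) (N : V → Prop) (h : ∃ x ∈ p.support, N x) :
    ∃ (s : V) (q : G.Walk u s) (r : G.Walk s v), p = q.append r ∧ N s ∧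
      ∀ x ∈ r.support, N x → x = s := by
  obtain ⟨s, q, r, e, hs, hq⟩ := first_hit p.reverse N (by simpa using h)
  refine ⟨s, r.reverse, q.reverse, ?_, hs, by simpa using hq⟩
  rw [← Walk.reverse_append, ← e, Walk.reverse_reverse]

lemma IP.split {u v : V} {S : Set V} {k : ℕ} (h : IP G u v S k) (N : V → Prop)
    (hN : ∃ x ∈ S, N x) :
    ∃ s t A B m n, IP G u s A m ∧ IP G t v B n ∧ A ⊆ S ∧ B ⊆ S ∧ N s ∧ N t ∧
      (∀ x ∈ A, N x → x = s) ∧ (∀ x ∈ B, N x → x = t) ∧ (v ∈ A → s = v) ∧ (u ∈ B → t = u) ∧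
      ((s = t ∧ m + n = k) ∨
        (s ≠ t ∧ (∀ x ∈ A, ∀ y ∈ B, x ≠ y ∧ (G.Adj x y → x = s ∧ y = t)) ∧
          (G.Adj s t → m + n + 1 = k))) := by
  obtain ⟨p, h1, h2, h3⟩ := h
  obtain ⟨s, q, r, e, hs, hq⟩ := first_hit p N (by simpa [h3] using hN)
  obtain ⟨t, b, c, e', ht, hc⟩ := last_hit r N ⟨s, by simp, hs⟩
  subst e'
  subst e
  have ir := ind_right h1
  refine ⟨s, t, {x | x ∈ q.support}, {x | x ∈ c.support}, q.length, c.length,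
    ⟨q, ind_left h1, rfl, by simp⟩, ⟨c, ind_right ir, rfl, by simp⟩, ?_, ?_, hs, ht, hq, hc,
    ?_, ?_, ?_⟩
  · intro x hx
    rw [← h3]; simp at hx; simp [hx]
  · intro x hx
    rw [← h3]; simp at hx; simp [hx]
  · intro hx
    exact (path_append_mid h1.1 hx (by simp)).symm
  · intro hx
    rw [Walk.append_assoc] at h1
    exact (path_append_mid h1.1 (by simp) hx).symm
  · by_cases hst : s = t
    · subst hst
      have e1 := isPath_nil b (ind_left ir).1
      subst e1
      left
      refine ⟨rfl, ?_⟩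
      simpa using h2
    · right
      have hd : ∀ x ∈ q.support, ∀ y ∈ c.support, x ≠ y := by
        rintro x hx _ hy rfl
        have e1 := path_append_mid h1.1 hx (by simp [hy])
        subst e1
        exact hst (path_append_mid ir.1 (by simp) hy)
      refine ⟨hst, fun x hx y hy => ⟨hd x hx y hy, fun hxy => ?_⟩, fun hadj => ?_⟩
      · rw [ind_iff] at h1
        simp only [Set.mem_ofPred_eq] at hx hy
        have := h1.2 x y (by simp [hx]) (by simp [hy]) hxy
        rw [Walk.edges_append, Walk.edges_append, List.mem_append, List.mem_append] at this
        rcases this with h | h | h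
        · exact absurd rfl (hd y (q.snd_mem_support_of_mem_edges h) y hy)
        · exact ⟨path_append_mid h1.1 hx (by simp [b.fst_mem_support_of_mem_edges h]),
            path_append_mid ir.1 (b.snd_mem_support_of_mem_edges h) hy⟩
        · exact absurd rfl (hd x hx x (c.fst_mem_support_of_mem_edges h))
      · have ib := ind_left ir
        rw [ind_iff] at ib
        have := ib.2 s t (by simp) (by simp) hadj
        cases b with
        | nil => exact absurd rfl hst
        | @cons _ y _ hy b' =>
          have hp := ib.1
          rw [Walk.cons_isPath_iff] at hp
          rw [Walk.edges_cons, List.mem_cons] at this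
          rcases this with he | he
          · have : t = y := by
              rw [Sym2.eq_iff] at he
              rcases he with ⟨-, h⟩ | ⟨h, h'⟩
              · exact h
              · exact absurd h'.symm hst
            subst this
            have e1 := isPath_nil b' hp.1
            subst e1
            rw [← h2]
            simp
            omega
          · exact absurd (b'.fst_mem_support_of_mem_edges he) hp.2

lemma IP.cut {u v x : V} {S : Set V} {k : ℕ} (h : IP G u v S k) (hx : x ∈ S) :
    ∃ A B m n, IP G u x A m ∧ IP G x v B n ∧ A ⊆ S ∧ B ⊆ S ∧ m + n = k := by
  obtain ⟨s, t, A, B, m, n, hA, hB, hAS, hBS, hs, ht, -, -, -, -, h⟩ :=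
    h.split (fun y => y = x) ⟨x, hx, rfl⟩
  subst hs
  subst ht
  rcases h with ⟨-, h⟩ | ⟨h, -⟩
  · exact ⟨A, B, m, n, hA, hB, hAS, hBS, h⟩
  · exact absurd rfl h

/-- The support of any walk contains a chordless path with the same ends. -/
lemma exists_IP {u v : V} (p : G.Walk u v) :
    ∃ S n, IP G u v S n ∧ ∀ x ∈ S, x ∈ p.support := by
  induction p with
  | nil => exact ⟨_, _, IP.single _, by simp⟩
  | @cons a b c hab p ih =>
    obtain ⟨S, n, h, hS⟩ := ih
    by_cases ha : a ∈ S
    · obtain ⟨A, B, m, n, -, hB, -, hBS, -⟩ := h.cut ha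
      exact ⟨B, n, hB, fun x hx => by simp [hS x (hBS hx)]⟩
    · obtain ⟨s, t, A, B, m, n, hA, hB, hAS, hBS, hs, ht, hA2, hB2, -⟩ :=
        h.split (fun y => G.Adj a y) ⟨b, h.fst, hab⟩
      refine ⟨_, _, (IP.single a).glue hB ht ?_, ?_⟩
      · intro x hx y hy
        simp only [Set.mem_singleton_iff] at hx
        subst hx
        exact ⟨fun e => ha (hBS (e ▸ hy)), fun hh => ⟨rfl, hB2 y hy hh⟩⟩
      · rintro x (hx | hx)
        · simp only [Set.mem_singleton_iff] at hx
          simp [hx]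
        · simp [hS x (hBS hx)]

/-- A prism, in terms of vertex sets. -/
structure Pri (G : SimpleGraph V) (a₁ a₂ a₃ b₁ b₂ b₃ : V) (S₁ S₂ S₃ : Set V) (k₁ k₂ k₃ : ℕ) :
    Prop where
  p₁ : IP G a₁ b₁ S₁ k₁
  p₂ : IP G a₂ b₂ S₂ k₂
  p₃ : IP G a₃ b₃ S₃ k₃
  a₁₂ : G.Adj a₁ a₂
  a₂₃ : G.Adj a₂ a₃
  a₁₃ : G.Adj a₁ a₃
  b₁₂ : G.Adj b₁ b₂
  b₂₃ : G.Adj b₂ b₃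
  b₁₃ : G.Adj b₁ b₃
  n₁ : a₁ ≠ b₁
  n₂ : a₂ ≠ b₂
  n₃ : a₃ ≠ b₃
  s₁₂ : ∀ x ∈ S₁, ∀ y ∈ S₂, x ≠ y ∧ (G.Adj x y → (x = a₁ ∧ y = a₂) ∨ (x = b₁ ∧ y = b₂))
  s₁₃ : ∀ x ∈ S₁, ∀ y ∈ S₃, x ≠ y ∧ (G.Adj x y → (x = a₁ ∧ y = a₃) ∨ (x = b₁ ∧ y = b₃))
  s₂₃ : ∀ x ∈ S₂, ∀ y ∈ S₃, x ≠ y ∧ (G.Adj x y → (x = a₂ ∧ y = a₃) ∨ (x = b₂ ∧ y = b₃))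

variable {a₁ a₂ a₃ b₁ b₂ b₃ : V} {S₁ S₂ S₃ : Set V} {k₁ k₂ k₃ : ℕ}

lemma Pri.swap (h : Pri G a₁ a₂ a₃ b₁ b₂ b₃ S₁ S₂ S₃ k₁ k₂ k₃) :
    Pri G a₁ a₃ a₂ b₁ b₃ b₂ S₁ S₃ S₂ k₁ k₃ k₂ where
  p₁ := h.p₁
  p₂ := h.p₃
  p₃ := h.p₂
  a₁₂ := h.a₁₃
  a₂₃ := h.a₂₃.symm
  a₁₃ := h.a₁₂
  b₁₂ := h.b₁₃
  b₂₃ := h.b₂₃.symm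
  b₁₃ := h.b₁₂
  n₁ := h.n₁
  n₂ := h.n₃
  n₃ := h.n₂
  s₁₂ := h.s₁₃
  s₁₃ := h.s₁₂
  s₂₃ := fun x hx y hy => ⟨(h.s₂₃ y hy x hx).1.symm, fun e => by
    have := (h.s₂₃ y hy x hx).2 e.symm
    tauto⟩

lemma Pri.par (hO : ¬ HasOddHole G) (h : Pri G a₁ a₂ a₃ b₁ b₂ b₃ S₁ S₂ S₃ k₁ k₂ k₃) :
    Even (k₁ + k₂) ∧ Even (k₁ + k₃) ∧ Even (k₂ + k₃) := by
  have e1 := h.p₁.pos h.n₁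
  have e2 := h.p₂.pos h.n₂
  have e3 := h.p₃.pos h.n₃
  exact ⟨h.p₁.hole hO h.p₂ h.a₁₂ h.b₁₂ (by omega) h.s₁₂,
    h.p₁.hole hO h.p₃ h.a₁₃ h.b₁₃ (by omega) h.s₁₃,
    h.p₂.hole hO h.p₃ h.a₂₃ h.b₂₃ (by omega) h.s₂₃⟩

/-- A connection `T` from `S₁` to `S₂ ∪ S₃` avoiding the neighbours of the corners. -/
structure Con (G : SimpleGraph V) (a₂ a₃ b₂ b₃ : V) (S₁ S₂ S₃ : Set V) (d c : V)
    (T : Set V) (q : ℕ) : Prop where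
  p : IP G d c T q
  na₂ : ∀ x ∈ T, ¬ G.Adj x a₂
  na₃ : ∀ x ∈ T, ¬ G.Adj x a₃
  nb₂ : ∀ x ∈ T, ¬ G.Adj x b₂
  nb₃ : ∀ x ∈ T, ¬ G.Adj x b₃
  t₁ : ∀ x ∈ T, ∀ y ∈ S₁, x ≠ y ∧ (G.Adj x y → x = d)
  t₂ : ∀ x ∈ T, ∀ y ∈ S₂, x ≠ y ∧ (G.Adj x y → x = c)
  t₃ : ∀ x ∈ T, ∀ y ∈ S₃, x ≠ y ∧ (G.Adj x y → x = c)
  e₁ : ∃ y ∈ S₁, G.Adj d y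

lemma core_both (hO : ¬ HasOddHole G) (h : Pri G a₁ a₂ a₃ b₁ b₂ b₃ S₁ S₂ S₃ k₁ k₂ k₃)
    {d c : V} {T : Set V} {q : ℕ} (hT : Con G a₂ a₃ b₂ b₃ S₁ S₂ S₃ d c T q)
    (e₂ : ∃ y ∈ S₂, G.Adj c y) (e₃ : ∃ y ∈ S₃, G.Adj c y) : False := by
  obtain ⟨s, -, A, -, m, -, hA, -, hAS, -, hs, -, hA2, -, -⟩ := h.p₁.split _ hT.e₁
  obtain ⟨u, -, C, -, m', -, hC, -, hCS, -, hu, -, hC2, -, hC3, -⟩ := h.p₂.split _ e₂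
  obtain ⟨v, -, D, -, m'', -, hD, -, hDS, -, hv, -, hD2, -, hD3, -⟩ := h.p₃.split _ e₃
  have hcT := hT.p.snd
  have hc1 := hT.na₂ c hcT
  have hc2 := hT.na₃ c hcT
  have hc3 := hT.nb₂ c hcT
  have hc4 := hT.nb₃ c hcT
  have l1 : 1 ≤ m' := hC.pos (by rintro rfl; exact hc1 hu)
  have l2 : 1 ≤ m'' := hD.pos (by rintro rfl; exact hc2 hv)
  have t1 := hT.t₁
  have t2 := hT.t₂
  have t3 := hT.t₃
  have s12 := h.s₁₂
  have s13 := h.s₁₃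
  have s23 := h.s₂₃
  have hbC : b₂ ∉ C := fun hb => hc3 (hC3 hb ▸ hu)
  have hbD : b₃ ∉ D := fun hb => hc4 (hD3 hb ▸ hv)
  have R : IP G c a₁ (T ∪ A) (q + m + 1) := by
    refine hT.p.rev.glue hA.rev hs (fun x hx y hy => ?_)
    have := t1 x hx y (hAS hy)
    grind
  have H1 := R.hole hO hC.rev hu h.a₁₂ (by omega) (by
    rintro x (hx | hx) y hy
    · have := t2 x hx y (hCS hy)
      grind
    · have := s12 x (hAS hx) y (hCS hy)
      grind)
  have H2 := R.hole hO hD.rev hv h.a₁₃ (by omega) (by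
    rintro x (hx | hx) y hy
    · have := t3 x hx y (hDS hy)
      grind
    · have := s13 x (hAS hx) y (hDS hy)
      grind)
  have R2 : IP G u v (C ∪ D) (m' + m'' + 1) := by
    refine hC.rev.glue hD h.a₂₃ (fun x hx y hy => ?_)
    have := s23 x (hCS hx) y (hDS hy)
    grind
  have H3 := (IP.single c).hole hO R2 hu hv (by omega) (by
    rintro x hx y (hy | hy)
    · rw [Set.mem_singleton_iff] at hx
      subst hx
      have := t2 x hcT y (hCS hy)
      grind
    · rw [Set.mem_singleton_iff] at hx
      subst hx
      have := t3 x hcT y (hDS hy)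
      grind)
  rw [Nat.even_iff] at *
  omega

set_option maxHeartbeats 4000000 in
lemma core_one (hO : ¬ HasOddHole G) (hL : ¬ ∃ D : LGSK4 G, D.Proper)
    (h : Pri G a₁ a₂ a₃ b₁ b₂ b₃ S₁ S₂ S₃ k₁ k₂ k₃)
    {d c : V} {T : Set V} {q : ℕ} (hT : Con G a₂ a₃ b₂ b₃ S₁ S₂ S₃ d c T q)
    (e₂ : ∃ y ∈ S₂, G.Adj c y) (e₃ : ¬ ∃ y ∈ S₃, G.Adj c y) : False := by
  obtain ⟨s, t, A, B, m, n, hA, hB, hAS, hBS, hs, ht, hA2, hB2, hA3, hB3, hst⟩ :=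
    h.p₁.split _ hT.e₁
  obtain ⟨u, v, C, D, m', n', hC, hD, hCS, hDS, hu, hv, hC2, hD2, hC3, hD3, huv⟩ :=
    h.p₂.split _ e₂
  have hdT := hT.p.fst
  have hcT := hT.p.snd
  have hc1 := hT.na₂ c hcT
  have hc3 := hT.nb₂ c hcT
  have l1 : 1 ≤ m' := hC.pos (by rintro rfl; exact hc1 hu)
  have l2 : 1 ≤ n' := hD.pos (by rintro rfl; exact hc3 hv)
  have l3 := h.p₃.pos h.n₃
  have t1 := hT.t₁
  have t2 := hT.t₂
  have t3 : ∀ x ∈ T, ∀ y ∈ S₃, x ≠ y ∧ ¬ G.Adj x y := fun x hx y hy =>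
    ⟨(hT.t₃ x hx y hy).1, fun hh => e₃ ⟨y, hy, (hT.t₃ x hx y hy).2 hh ▸ hh⟩⟩
  have s12 := h.s₁₂
  have s13 := h.s₁₃
  have s23 := h.s₂₃
  have n1 := h.n₁
  have hbC : b₂ ∉ C := fun hb => hc3 (hC3 hb ▸ hu)
  have haD : a₂ ∉ D := fun hb => hc1 (hD3 hb ▸ hv)
  obtain ⟨par1, par2, par3⟩ := h.par hO
  have RA : IP G c a₁ (T ∪ A) (q + m + 1) := by
    refine hT.p.rev.glue hA.rev hs (fun x hx y hy => ?_)
    have := t1 x hx y (hAS hy)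
    grind
  have RB : IP G c b₁ (T ∪ B) (q + n + 1) := by
    refine hT.p.rev.glue hB ht (fun x hx y hy => ?_)
    have := t1 x hx y (hBS hy)
    grind
  have HA := RA.hole hO hC.rev hu h.a₁₂ (by omega) (by
    rintro x (hx | hx) y hy
    · have := t2 x hx y (hCS hy)
      grind
    · have := s12 x (hAS hx) y (hCS hy)
      grind)
  have HB := RB.hole hO hD hv h.b₁₂ (by omega) (by
    rintro x (hx | hx) y hy
    · have := t2 x hx y (hDS hy)
      grind
    · have := s12 x (hBS hx) y (hDS hy)
      grind)
  -- the path from `u` to `b₃` through `a₂`, and the one from `v` to `a₃` through `b₂`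
  have RC : IP G u b₃ (C ∪ S₃) (m' + k₃ + 1) := by
    refine hC.rev.glue h.p₃ h.a₂₃ (fun x hx y hy => ?_)
    have := s23 x (hCS hx) y hy
    grind
  have RD : IP G v a₃ (D ∪ S₃) (n' + k₃ + 1) := by
    refine hD.glue h.p₃.rev h.b₂₃ (fun x hx y hy => ?_)
    have := s23 x (hDS hx) y hy
    grind
  have key : Even (m' + n' + k₃ + 1) := by
    by_cases hsb : s = b₁
    · have hta : a₁ ∉ B := by
        intro hb
        have e := hB3 hb
        rcases hst with hst | hst
        · exact n1 (by rw [← e, ← hst.1, hsb])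
        · have hbB := hB.snd
          have hsA := hA.snd
          exact (hst.2.1 s hsA b₁ hbB).1 hsb
      have H := RB.hole hO RC hu h.b₁₃ (by omega) (by
        rintro x (hx | hx) y (hy | hy)
        · have := t2 x hx y (hCS hy)
          grind
        · have := t3 x hx y hy
          grind
        · have := s12 x (hBS hx) y (hCS hy)
          grind
        · have := s13 x (hBS hx) y hy
          grind)
      rw [Nat.even_iff] at *
      omega
    · have hsA : b₁ ∉ A := fun hb => hsb (hA3 hb)
      have H := RA.hole hO RD hv h.a₁₃ (by omega) (by
        rintro x (hx | hx) y (hy | hy)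
        · have := t2 x hx y (hDS hy)
          grind
        · have := t3 x hx y hy
          grind
        · have := s12 x (hAS hx) y (hDS hy)
          grind
        · have := s13 x (hAS hx) y hy
          grind)
      rw [Nat.even_iff] at *
      omega
  rcases huv with ⟨huv, hlen⟩ | ⟨huv, hCD, hlen⟩
  · rw [Nat.even_iff] at *
    omega
  by_cases hadj : G.Adj u v
  swap
  · have hCD' : ∀ x ∈ C, ∀ y ∈ D, x ≠ y ∧ ¬ G.Adj x y := fun x hx y hy =>
      ⟨(hCD x hx y hy).1, fun hh => by
        obtain ⟨rfl, rfl⟩ := (hCD x hx y hy).2 hh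
        exact hadj hh⟩
    have R : IP G u v ((C ∪ S₃) ∪ D) (m' + k₃ + 1 + n' + 1) := by
      refine RC.glue hD.rev h.b₂₃.symm ?_
      rintro x (hx | hx) y hy
      · have := hCD' x hx y hy
        grind
      · have := s23 y (hDS hy) x hx
        have := G.adj_comm x y
        grind
    have H := (IP.single c).hole hO R hu hv (by omega) (by
      rintro x hx y hy
      rw [Set.mem_singleton_iff] at hx
      subst hx
      rcases hy with (hy | hy) | hy
      · have := t2 x hcT y (hCS hy)
        grind
      · have := t3 x hcT y hy
        grind
      · have := t2 x hcT y (hDS hy)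
        grind)
    rw [Nat.even_iff] at *
    omega
  have hlen := hlen hadj
  rcases hst with ⟨hst, hlen'⟩ | ⟨hst, hAB, hlen'⟩
  · rw [Nat.even_iff] at *
    omega
  by_cases hadj' : G.Adj s t
  swap
  · have hAB' : ∀ x ∈ A, ∀ y ∈ B, x ≠ y ∧ ¬ G.Adj x y := fun x hx y hy =>
      ⟨(hAB x hx y hy).1, fun hh => by
        obtain ⟨rfl, rfl⟩ := (hAB x hx y hy).2 hh
        exact hadj' hh⟩
    have hbA : b₁ ∉ A := fun hb => (hAB b₁ hb b₁ hB.snd).1 rfl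
    have haB : a₁ ∉ B := fun hb => (hAB a₁ hA.fst a₁ hb).1 rfl
    have R1 : IP G s b₃ (A ∪ S₃) (m + k₃ + 1) := by
      refine hA.rev.glue h.p₃ h.a₁₃ (fun x hx y hy => ?_)
      have := s13 x (hAS hx) y hy
      grind
    have R : IP G s t ((A ∪ S₃) ∪ B) (m + k₃ + 1 + n + 1) := by
      refine R1.glue hB.rev h.b₁₃.symm ?_
      rintro x (hx | hx) y hy
      · have := hAB' x hx y hy
        grind
      · have := s13 y (hBS hy) x hx
        have := G.adj_comm x y
        grind
    have H := (IP.single d).hole hO R hs ht (by omega) (by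
      rintro x hx y hy
      rw [Set.mem_singleton_iff] at hx
      subst hx
      rcases hy with (hy | hy) | hy
      · have := t1 x hdT y (hAS hy)
        grind
      · have := t3 x hdT y hy
        grind
      · have := t1 x hdT y (hBS hy)
        grind)
    rw [Nat.even_iff] at *
    omega
  -- the remaining case: a line graph of a proper subdivision of `K₄`
  have hbA : b₁ ∉ A := fun hb => (hAB b₁ hb b₁ hB.snd).1 rfl
  have haB : a₁ ∉ B := fun hb => (hAB a₁ hA.fst a₁ hb).1 rfl
  have hAS' : ∀ x ∈ A, x ∈ S₁ := fun x hx => hAS hx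
  have hBS' : ∀ x ∈ B, x ∈ S₁ := fun x hx => hBS hx
  have hCS' : ∀ x ∈ C, x ∈ S₂ := fun x hx => hCS hx
  have hDS' : ∀ x ∈ D, x ∈ S₂ := fun x hx => hDS hx
  obtain ⟨wA, iA, -, fA⟩ := hA
  obtain ⟨wB, iB, -, fB⟩ := hB.rev
  obtain ⟨wC, iC, lC, fC⟩ := hC
  obtain ⟨wD, iD, -, fD⟩ := hD.rev
  obtain ⟨w3, i3, -, f3⟩ := h.p₃
  obtain ⟨wT, iT, -, fT⟩ := hT.p
  apply hL
  -- triangles: `a = {a₁,a₂,a₃}`, `b = {b₁,b₂,b₃}`, `c = {s,t,d}`, `d = {u,v,c}`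
  refine ⟨{
    vab := a₃, vac := a₁, vad := a₂
    vba := b₃, vbc := b₁, vbd := b₂
    vca := s, vcb := t, vcd := d
    vda := u, vdb := v, vdc := c
    Rab := w3, Rac := wA, Rad := wC, Rbc := wB, Rbd := wD, Rcd := wT
    ind_ab := i3, ind_ac := iA, ind_ad := iC, ind_bc := iB, ind_bd := iD, ind_cd := iT
    tri_a := ⟨h.a₁₃.symm, h.a₂₃.symm, h.a₁₂⟩
    tri_b := ⟨h.b₁₃.symm, h.b₂₃.symm, h.b₁₂⟩
    tri_c := ⟨hadj', hs.symm, ht.symm⟩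
    tri_d := ⟨hadj, hu.symm, hv.symm⟩
    share_ab_ac := ?_
    share_ab_ad := ?_
    share_ac_ad := ?_
    share_ab_bc := ?_
    share_ab_bd := ?_
    share_bc_bd := ?_
    share_ac_bc := ?_
    share_ac_cd := ?_
    share_bc_cd := ?_
    share_ad_bd := ?_
    share_ad_cd := ?_
    share_bd_cd := ?_
    opp_ab_cd := ?_
    opp_ac_bd := ?_
    opp_ad_bc := ?_ }, ?_⟩
  case refine_16 => exact Or.inr (Or.inr (Or.inl (by show 1 ≤ wC.length; omega)))
  all_goals
    clear par1 par2 par3 RA RB HA HB RC RD key hlen hlen' hAS hBS hCS hDS e₂ e₃ hL hO lC l1 l2 l3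
    simp only [RungShare, RungOpp, fA, fB, fC, fD, f3, fT]
    constructor
    · intro x hx hy
      clear fA fB fC fD f3 fT
      grind
    · intro x hx y hy hxy
      clear fA fB fC fD f3 fT
      have hyx := hxy.symm
      grind

lemma core (hO : ¬ HasOddHole G) (hL : ¬ ∃ D : LGSK4 G, D.Proper)
    (h : Pri G a₁ a₂ a₃ b₁ b₂ b₃ S₁ S₂ S₃ k₁ k₂ k₃)
    {d c : V} {T : Set V} {q : ℕ} (hT : Con G a₂ a₃ b₂ b₃ S₁ S₂ S₃ d c T q)
    (e : ∃ y, (y ∈ S₂ ∨ y ∈ S₃) ∧ G.Adj c y) : False := by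
  by_cases e₂ : ∃ y ∈ S₂, G.Adj c y <;> by_cases e₃ : ∃ y ∈ S₃, G.Adj c y
  · exact core_both hO h hT e₂ e₃
  · exact core_one hO hL h hT e₂ e₃
  · exact core_one hO hL h.swap
      ⟨hT.p, hT.na₃, hT.na₂, hT.nb₃, hT.nb₂, hT.t₁, hT.t₃, hT.t₂, hT.e₁⟩ e₃ e₂
  · obtain ⟨y, hy | hy, hc⟩ := e
    · exact e₂ ⟨y, hy, hc⟩
    · exact e₃ ⟨y, hy, hc⟩

lemma IP.nbr {u v x : V} {S : Set V} {n : ℕ} (h : IP G u v S n) (hn : u ≠ v) (hx : x ∈ S) :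
    ∃ y ∈ S, G.Adj x y := by
  obtain ⟨A, B, m, n, hA, hB, hAS, hBS, -⟩ := h.cut hx
  by_cases hxv : x = v
  · obtain ⟨p, -, -, hp⟩ := hA.rev
    cases p with
    | nil => exact absurd hxv hn
    | @cons _ y _ hxy p => exact ⟨y, hAS ((hp y).1 (by simp)), hxy⟩
  · obtain ⟨p, -, -, hp⟩ := hB
    cases p with
    | nil => exact absurd rfl hxv
    | @cons _ y _ hxy p => exact ⟨y, hBS ((hp y).1 (by simp)), hxy⟩

/-- There is no connection at all: take a shortest one and apply `core`. -/
lemma no_con (hO : ¬ HasOddHole G) (hL : ¬ ∃ D : LGSK4 G, D.Proper)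
    (h : Pri G a₁ a₂ a₃ b₁ b₂ b₃ S₁ S₂ S₃ k₁ k₂ k₃) (q : ℕ) :
    ∀ (d c : V) (T : Set V), IP G d c T q →
    (∀ x ∈ T, ¬ G.Adj x a₂ ∧ ¬ G.Adj x a₃ ∧ ¬ G.Adj x b₂ ∧ ¬ G.Adj x b₃) →
    (∃ y ∈ S₁, G.Adj d y) → (∃ y, (y ∈ S₂ ∨ y ∈ S₃) ∧ G.Adj c y) → False := by
  induction q using Nat.strong_induction_on with
  | _ q ih =>
  intro d c T hT hN hd hc
  have f1 : ∀ x ∈ T, (∃ y ∈ S₁, G.Adj x y) → x = d := by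
    intro x hx hy
    obtain ⟨A, B, m, n, hA, hB, hAS, hBS, hmn⟩ := hT.cut hx
    by_contra hne
    have := hA.pos (Ne.symm hne)
    exact ih n (by omega) x c B hB (fun z hz => hN z (hBS hz)) hy hc
  have f2 : ∀ x ∈ T, (∃ y, (y ∈ S₂ ∨ y ∈ S₃) ∧ G.Adj x y) → x = c := by
    intro x hx hy
    obtain ⟨A, B, m, n, hA, hB, hAS, hBS, hmn⟩ := hT.cut hx
    by_contra hne
    have := hB.pos hne
    exact ih m (by omega) d x A hA (fun z hz => hN z (hAS hz)) hd hy
  have n23 := h.s₂₃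
  have g1 : ∀ x ∈ T, x ∉ S₁ := by
    intro x hx hxS
    have hxd := f1 x hx (h.p₁.nbr h.n₁ hxS)
    subst hxd
    by_cases hxc : x = c
    · subst hxc
      obtain ⟨y, hy | hy, hxy⟩ := hc
      · rcases (h.s₁₂ x hxS y hy).2 hxy with ⟨-, rfl⟩ | ⟨-, rfl⟩
        · exact (hN x hx).1 hxy
        · exact (hN x hx).2.2.1 hxy
      · rcases (h.s₁₃ x hxS y hy).2 hxy with ⟨-, rfl⟩ | ⟨-, rfl⟩
        · exact (hN x hx).2.1 hxy
        · exact (hN x hx).2.2.2 hxy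
    · obtain ⟨z, hz, hxz⟩ := hT.nbr hxc hx
      have := f1 z hz ⟨x, hxS, hxz.symm⟩
      exact hxz.ne this.symm
  have g2 : ∀ x ∈ T, ¬ (x ∈ S₂ ∨ x ∈ S₃) := by
    intro x hx hxS
    have hxc : x = c := by
      apply f2 x hx
      rcases hxS with hxS | hxS
      · obtain ⟨y, hy, hxy⟩ := h.p₂.nbr h.n₂ hxS
        exact ⟨y, Or.inl hy, hxy⟩
      · obtain ⟨y, hy, hxy⟩ := h.p₃.nbr h.n₃ hxS
        exact ⟨y, Or.inr hy, hxy⟩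
    subst hxc
    by_cases hxd : d = x
    · subst hxd
      obtain ⟨y, hy, hxy⟩ := hd
      rcases hxS with hxS | hxS
      · rcases (h.s₁₂ y hy d hxS).2 hxy.symm with ⟨-, rfl⟩ | ⟨-, rfl⟩
        · exact (hN _ hx).2.1 h.a₂₃
        · exact (hN _ hx).2.2.2 h.b₂₃
      · rcases (h.s₁₃ y hy d hxS).2 hxy.symm with ⟨-, rfl⟩ | ⟨-, rfl⟩
        · exact (hN _ hx).1 h.a₂₃.symm
        · exact (hN _ hx).2.2.1 h.b₂₃.symm
    · obtain ⟨z, hz, hxz⟩ := hT.nbr hxd hx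
      have := f2 z hz ⟨x, hxS, hxz.symm⟩
      exact hxz.ne this.symm
  refine core hO hL h (d := d) (c := c) (T := T) (q := q)
    ⟨hT, fun x hx => (hN x hx).1, fun x hx => (hN x hx).2.1, fun x hx => (hN x hx).2.2.1,
      fun x hx => (hN x hx).2.2.2, ?_, ?_, ?_, hd⟩ hc
  · exact fun x hx y hy => ⟨fun e => g1 x hx (e ▸ hy), fun hxy => f1 x hx ⟨y, hy, hxy⟩⟩
  · exact fun x hx y hy => ⟨fun e => g2 x hx (Or.inl (e ▸ hy)),
      fun hxy => f2 x hx ⟨y, Or.inl hy, hxy⟩⟩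
  · exact fun x hx y hy => ⟨fun e => g2 x hx (Or.inr (e ▸ hy)),
      fun hxy => f2 x hx ⟨y, Or.inr hy, hxy⟩⟩

lemma IP.of_walk {u v : V} {p : G.Walk u v} (h : IsInducedPathW G p) :
    IP G u v {x | x ∈ p.support} p.length := ⟨p, h, rfl, by simp⟩

lemma Pri.of_isPrism {P₁ : G.Walk a₁ b₁} {P₂ : G.Walk a₂ b₂} {P₃ : G.Walk a₃ b₃}
    (hH : IsPrism G a₁ a₂ a₃ b₁ b₂ b₃ P₁ P₂ P₃) :
    Pri G a₁ a₂ a₃ b₁ b₂ b₃ {x | x ∈ P₁.support} {x | x ∈ P₂.support} {x | x ∈ P₃.support}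
      P₁.length P₂.length P₃.length := by
  obtain ⟨i1, i2, i3, a12, a23, a13, b12, b23, b13, n1, n2, n3, s12, s13, s23⟩ := hH
  refine ⟨.of_walk i1, .of_walk i2, .of_walk i3, a12, a23, a13, b12, b23, b13, n1, n2, n3,
    ?_, ?_, ?_⟩
  · exact fun x hx y hy => ⟨fun e => s12.1 x hx (e ▸ hy), s12.2 x hx y hy⟩
  · exact fun x hx y hy => ⟨fun e => s13.1 x hx (e ▸ hy), s13.2 x hx y hy⟩
  · exact fun x hx y hy => ⟨fun e => s23.1 x hx (e ▸ hy), s23.2 x hx y hy⟩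

end PrismAux

/-- Let `G` contain no odd hole and no induced line-graph of a proper
subdivision of `K₄`. Let `H` be an induced prism of `G` formed by `P₁, P₂, P₃`, and
let `P` be any chordless path from `a₁` to `b₁` whose interior vertices are not
adjacent to `a₂, a₃, b₂, b₃`. Then `P, P₂, P₃` form an induced prism of `G` of the
same parity as `H`. -/
theorem prism_replace_path_same_parity
    {V : Type*} [Fintype V] [DecidableEq V] (G : SimpleGraph V)
    (hOH : ¬ HasOddHole G)
    (hLG : ¬ ∃ D : LGSK4 G, D.Proper)
    (a₁ a₂ a₃ b₁ b₂ b₃ : V)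
    (P₁ : G.Walk a₁ b₁) (P₂ : G.Walk a₂ b₂) (P₃ : G.Walk a₃ b₃)
    (hH : IsPrism G a₁ a₂ a₃ b₁ b₂ b₃ P₁ P₂ P₃)
    (P : G.Walk a₁ b₁) (hP : IsInducedPathW G P)
    (hPint : ∀ x ∈ P.support, x ≠ a₁ → x ≠ b₁ →
      ¬ G.Adj x a₂ ∧ ¬ G.Adj x a₃ ∧ ¬ G.Adj x b₂ ∧ ¬ G.Adj x b₃) :
    IsPrism G a₁ a₂ a₃ b₁ b₂ b₃ P P₂ P₃ ∧ P.length % 2 = P₁.length % 2 := by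
  have hPr := PrismAux.Pri.of_isPrism hH
  have key : ∀ x ∈ P.support, x ≠ a₁ → x ≠ b₁ →
      ∀ y, (y ∈ P₂.support ∨ y ∈ P₃.support) → ¬ G.Adj x y := by
    intro x hx hxa hxb y hy hxy
    -- the part of `P` strictly between `a₁` and `x`, followed by `x`
    cases P with
    | nil => exact hPr.n₁ rfl
    | @cons _ z _ haz p =>
      have hpath := hP.1
      rw [Walk.cons_isPath_iff] at hpath
      have hxp : x ∈ p.support := by
        rw [Walk.support_cons, List.mem_cons] at hx
        exact hx.resolve_left hxa
      obtain ⟨r, r', hr⟩ := Walk.mem_support_iff_exists_append.1 hxp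
      subst hr
      obtain ⟨T, q, hT, hTr⟩ := PrismAux.exists_IP r
      refine PrismAux.no_con hOH hLG hPr q z x T hT ?_ ⟨a₁, by simp, haz.symm⟩ ⟨y, hy, hxy⟩
      intro w hw
      have hwr := hTr w hw
      refine hPint w (by simp [hwr]) ?_ ?_
      · rintro rfl
        exact hpath.2 (by simp [hwr])
      · rintro rfl
        exact hxb (PrismAux.path_append_mid hpath.1 hwr (by simp)).symm
  have hnew : IsPrism G a₁ a₂ a₃ b₁ b₂ b₃ P P₂ P₃ := by
    obtain ⟨i1, i2, i3, a12, a23, a13, b12, b23, b13, n1, n2, n3, s12, s13, s23⟩ := hH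
    refine ⟨hP, i2, i3, a12, a23, a13, b12, b23, b13, n1, n2, n3, ⟨?_, ?_⟩, ⟨?_, ?_⟩, s23⟩
    · intro x hx hx2
      by_cases hxa : x = a₁
      · exact s12.1 x (by simp [hxa]) hx2
      by_cases hxb : x = b₁
      · exact s12.1 x (by simp [hxb]) hx2
      obtain ⟨y, hy, hxy⟩ := hPr.p₂.nbr n2 hx2
      exact key x hx hxa hxb y (Or.inl hy) hxy
    · intro x hx y hy hxy
      by_cases hxa : x = a₁
      · exact s12.2 x (by simp [hxa]) y hy hxy
      by_cases hxb : x = b₁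
      · exact s12.2 x (by simp [hxb]) y hy hxy
      exact absurd hxy (key x hx hxa hxb y (Or.inl hy))
    · intro x hx hx2
      by_cases hxa : x = a₁
      · exact s13.1 x (by simp [hxa]) hx2
      by_cases hxb : x = b₁
      · exact s13.1 x (by simp [hxb]) hx2
      obtain ⟨y, hy, hxy⟩ := hPr.p₃.nbr n3 hx2
      exact key x hx hxa hxb y (Or.inr hy) hxy
    · intro x hx y hy hxy
      by_cases hxa : x = a₁
      · exact s13.2 x (by simp [hxa]) y hy hxy
      by_cases hxb : x = b₁
      · exact s13.2 x (by simp [hxb]) y hy hxy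
      exact absurd hxy (key x hx hxa hxb y (Or.inr hy))
  refine ⟨hnew, ?_⟩
  have q1 := ((PrismAux.Pri.of_isPrism hnew).par hOH).1
  have q2 := (hPr.par hOH).1
  rw [Nat.even_iff] at q1 q2
  omega
end
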